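/- arXiv:2510.20765 — 3 statements merged into one kernel-verified Lean document; each statement's English description precedes it below -/
import Mathlib

section
/- There is an absolute constant c* > 0 such that the following holds. Let n ∈ ℕ, d ∈ [n], δ > 0, and let η and C₀ satisfy 0 < η ≤ c*, 0 < 1/C₀ ≤ c*, η·d ≥ C₀ and η²·δ ≥ C₀·log n. Let ℓ be an integer with 4 ≤ ℓ ≤ 10·log n. Let F be a graph on [n] with 𝒦_d(F) ≠ ∅ such that (A1) for every v ∈ [n], d + (1−η)δ ≤ d_F(v) ≤ d + (1+η)δ. Suppose that for all but at most n^{−6}·|𝒦_d(F)| graphs K ∈ 𝒦_d(F) the following two conditions hold: (A2) for each pair of distinct x, y ∈ [n] and each Z ⊆ [n] with |Z| ≤ 4ℓ, the number of (F∖K, K)-alternating x,y-paths of length 2ℓ with no internal vertex in Z is at least (1 − η − |(Z ∪ {x}) ∩ N_K(y)|/d)·d^ℓ·δ^ℓ/n; (A3) for each pair of distinct x, y ∈ [n], the number of (F∖K, K)-alternating x,y-paths of length 2ℓ is at most (1+η)·d^ℓ·δ^ℓ/n. Then for all e, f ∈ E(F), |{K ∈ 𝒦_d(F) : e ∈ E(K)}|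 ≤ (1+40η)·|{K ∈ 𝒦_d(F) : f ∈ E(K)}|. (Theorem 4.1, the main switching argument.) -/
open scoped Classical ENNReal

noncomputable section

namespace Sandwich

variable {n : ℕ}

/-- The degree of the vertex `v` in the graph `G`. -/
def deg (G : SimpleGraph (Fin n)) (v : Fin n) : ℕ := Nat.card (G.neighborSet v)

/-- `G` is a `d`-regular graph. -/
def IsRegularGraph (G : SimpleGraph (Fin n)) (d : ℕ) : Prop := ∀ v, deg G v = d

/-- The number of edges of `G`. -/
def edgeCount (G : SimpleGraph (Fin n)) : ℕ := G.edgeSet.ncard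

/-- The probability of the event `P` under the probability mass function `μ`. -/
def prEvent {α : Type*} (μ : PMF α) (P : α → Prop) : ℝ≥0∞ := ∑' a, if P a then μ a else 0

/-- `μ` is the uniform distribution on the set `S`. -/
def IsUniformOn {α : Type*} (μ : PMF α) (S : Set α) : Prop :=
  ∀ a, μ a = if a ∈ S then (S.ncard : ℝ≥0∞)⁻¹ else 0

/-- `P` lists the `k+1` vertices of a `(G₁,G₂)`-alternating path of length `k`: the vertices
are distinct and consecutive vertices are joined by an edge of `G₁` (for steps of even index)
or of `G₂` (for steps of odd index). -/
def IsAltSeq (G₁ G₂ : SimpleGraph (Fin n)) (k : ℕ) (P : Fin (k + 1) → Fin n) : Prop :=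
  Function.Injective P ∧
    ∀ i : Fin k, if (i : ℕ) % 2 = 0 then G₁.Adj (P i.castSucc) (P i.succ)
      else G₂.Adj (P i.castSucc) (P i.succ)

/-- The number of `(G₁,G₂)`-alternating `x,y`-paths of length `k` with no internal vertex
in `Z`. -/
def altPathCount (G₁ G₂ : SimpleGraph (Fin n)) (k : ℕ) (x y : Fin n) (Z : Set (Fin n)) : ℕ :=
  Nat.card {P : Fin (k + 1) → Fin n // IsAltSeq G₁ G₂ k P ∧ P 0 = x ∧ P (Fin.last k) = y ∧
    ∀ i : Fin (k + 1), i ≠ 0 → i ≠ Fin.last k → P i ∉ Z}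

/-- The number of `(G₁,G₂)`-alternating paths of length `k` starting at `x`. -/
def altStartCount (G₁ G₂ : SimpleGraph (Fin n)) (k : ℕ) (x : Fin n) : ℕ :=
  Nat.card {P : Fin (k + 1) → Fin n // IsAltSeq G₁ G₂ k P ∧ P 0 = x}

/-- The external neighbourhood `N_G(U)` of a set of vertices `U`. -/
def nbhd (G : SimpleGraph (Fin n)) (U : Set (Fin n)) : Set (Fin n) :=
  {v | v ∉ U ∧ ∃ u ∈ U, G.Adj u v}

/-- `e_G(U)`, the number of edges of `G` with both endpoints in `U`. -/
def edgesWithin (G : SimpleGraph (Fin n)) (U : Set (Fin n)) : ℕ :=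
  {e ∈ G.edgeSet | ∀ v ∈ e, v ∈ U}.ncard

/-- `e_G(U,V) = |{(u,v) : u ∈ U, v ∈ V, uv ∈ E(G)}|`. -/
def edgesBetween (G : SimpleGraph (Fin n)) (U V : Set (Fin n)) : ℕ :=
  {p : Fin n × Fin n | p.1 ∈ U ∧ p.2 ∈ V ∧ G.Adj p.1 p.2}.ncard

/-- `|E_{≥2,G}(U)|`, the number of edges `xy ∈ E(G)` with `x ∈ U`, `y ∉ U` such that some
`x' ∈ U ∖ {x}` also satisfies `x'y ∈ E(G)`. -/
def E2count (G : SimpleGraph (Fin n)) (U : Set (Fin n)) : ℕ :=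
  {e : Sym2 (Fin n) | e ∈ G.edgeSet ∧ ∃ x y, e = s(x, y) ∧ x ∈ U ∧ y ∉ U ∧
    ∃ x' ∈ U, x' ≠ x ∧ G.Adj x' y}.ncard

/-- `Σ_{u ∈ N_{F∖K}(v)} Σ_{u' ∈ N_K(u)} d_{F∖K}(u')`. -/
def doubleDegSum (F K : SimpleGraph (Fin n)) (v : Fin n) : ℝ :=
  ∑ u : Fin n, if (F \ K).Adj v u then
    ∑ u' : Fin n, if K.Adj u u' then (deg (F \ K) u' : ℝ) else 0
  else 0

/-- `μ` is the law of the binomial random graph `G(n,p)`. -/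
def IsGnp (μ : PMF (SimpleGraph (Fin n))) (p : ℝ) : Prop :=
  ∀ G, μ G = ENNReal.ofReal (p ^ edgeCount G * (1 - p) ^ (n.choose 2 - edgeCount G))

/-- `μ` is the law of `G(n,p)`, where `p` is truncated to `[0,1]` (so that `G(n,p)` is the
empty graph for `p ≤ 0` and the complete graph for `p ≥ 1`). -/
def IsGnpLaw (μ : PMF (SimpleGraph (Fin n))) (p : ℝ) : Prop :=
  IsGnp μ (max 0 (min p 1))

/-- `μ` is the law of `K + E`, where `E` includes each pair not in `E(K)` independently with
probability `p`. -/
def IsAddGnp (μ : PMF (SimpleGraph (Fin n))) (K : SimpleGraph (Fin n)) (p : ℝ) : Prop :=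
  ∀ F, μ F = if K ≤ F then
      ENNReal.ofReal (p ^ (edgeCount F - edgeCount K) * (1 - p) ^ (n.choose 2 - edgeCount F))
    else 0

/-- `ν` is the joint law of `(K, F)` where `K ~ G_d(n)` is a uniformly random `d`-regular graph
and `F = K + E`, `E` including each pair not in `E(K)` independently with probability `p`. -/
def IsRegAddGnp (ν : PMF (SimpleGraph (Fin n) × SimpleGraph (Fin n))) (d : ℕ) (p : ℝ) : Prop :=
  ∀ w, ν w = if IsRegularGraph w.1 d ∧ w.1 ≤ w.2 then
      ({G : SimpleGraph (Fin n) | IsRegularGraph G d}.ncard : ℝ≥0∞)⁻¹ *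
        ENNReal.ofReal (p ^ (edgeCount w.2 - edgeCount w.1) *
          (1 - p) ^ (n.choose 2 - edgeCount w.2))
    else 0

/-- `ν` is the joint law of an independent pair `(K, F)` with `K ~ G_d(n)` and `F ~ G(n,q)`. -/
def IsRegIndepGnp (ν : PMF (SimpleGraph (Fin n) × SimpleGraph (Fin n))) (d : ℕ) (q : ℝ) :
    Prop :=
  ∀ w, ν w = (if IsRegularGraph w.1 d then
      ({G : SimpleGraph (Fin n) | IsRegularGraph G d}.ncard : ℝ≥0∞)⁻¹ else 0) *
      ENNReal.ofReal (q ^ edgeCount w.2 * (1 - q) ^ (n.choose 2 - edgeCount w.2))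


/-- The graph formed by the edges of the closed walk `Q 0, Q 1, …, Q (m - 1), Q 0`. -/
def closedWalkGraph {m : ℕ} [NeZero m] (Q : Fin m → Fin n) : SimpleGraph (Fin n) :=
  SimpleGraph.fromRel fun x y => ∃ i, x = Q i ∧ y = Q (i + 1)

/-- `Q` lists the vertices of a cycle whose edges alternate between `G₁` and `G₂`. -/
def IsAltCycle (G₁ G₂ : SimpleGraph (Fin n)) {m : ℕ} [NeZero m] (Q : Fin m → Fin n) : Prop :=
  Function.Injective Q ∧ ∀ i : Fin m,
    if (i : ℕ) % 2 = 0 then G₁.Adj (Q i) (Q (i + 1)) else G₂.Adj (Q i) (Q (i + 1))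

lemma closedWalkGraph_adj {m : ℕ} [NeZero m] {Q : Fin m → Fin n} (hQ : Function.Injective Q)
    (j : Fin m) (t : Fin n) :
    (closedWalkGraph Q).Adj (Q j) t ↔ Q j ≠ t ∧ (t = Q (j + 1) ∨ t = Q (j - 1)) := by
  simp only [closedWalkGraph, SimpleGraph.fromRel_adj]
  refine and_congr_right fun _ => or_congr ?_ ?_
  · constructor
    · rintro ⟨i, hi, rfl⟩
      rw [hQ hi]
    · rintro rfl
      exact ⟨j, rfl, rfl⟩
  · constructor
    · rintro ⟨i, rfl, hi⟩
      rw [hQ hi, add_sub_cancel_right]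
    · rintro rfl
      exact ⟨j - 1, rfl, by rw [sub_add_cancel]⟩

lemma closedWalkGraph_adj_exists {m : ℕ} [NeZero m] {Q : Fin m → Fin n} {x y : Fin n}
    (h : (closedWalkGraph Q).Adj x y) : ∃ j, Q j = x := by
  simp only [closedWalkGraph, SimpleGraph.fromRel_adj] at h
  rcases h with ⟨-, ⟨i, hi, -⟩ | ⟨i, -, hi⟩⟩
  exacts [⟨i, hi.symm⟩, ⟨i + 1, hi.symm⟩]

lemma symmDiff_adj (G H : SimpleGraph (Fin n)) (x y : Fin n) :
    (symmDiff G H).Adj x y ↔ (G.Adj x y ∧ ¬ H.Adj x y) ∨ (H.Adj x y ∧ ¬ G.Adj x y) := by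
  simp [symmDiff_def]

lemma val_add_one_mod_two {k : ℕ} (i : Fin (2 * k + 1 + 1)) :
    ((i + 1 : Fin (2 * k + 1 + 1)) : ℕ) % 2 = ((i : ℕ) + 1) % 2 := by
  rw [Fin.val_add_one]
  split_ifs with h
  · subst h
    simp only [Fin.val_last]
    omega
  · rfl

/-- Switching the edges of an alternating cycle exchanges the two classes of its edges. -/
lemma IsAltCycle.switch {F K : SimpleGraph (Fin n)} {k : ℕ} {Q : Fin (2 * k + 1 + 1) → Fin n}
    (hQ : IsAltCycle K (F \ K) Q) (hKF : K ≤ F) :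
    IsAltCycle (F \ symmDiff K (closedWalkGraph Q)) (symmDiff K (closedWalkGraph Q)) Q := by
  refine ⟨hQ.1, fun i => ?_⟩
  have hi := hQ.2 i
  have hC : Q i ≠ Q (i + 1) → (closedWalkGraph Q).Adj (Q i) (Q (i + 1)) := fun h =>
    (closedWalkGraph_adj hQ.1 i _).2 ⟨h, Or.inl rfl⟩
  split_ifs with h
  · rw [if_pos h] at hi
    rw [SimpleGraph.sdiff_adj, symmDiff_adj]
    exact ⟨hKF hi, by have := hC hi.ne; tauto⟩
  · rw [if_neg h] at hi
    rw [symmDiff_adj]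
    exact Or.inr ⟨hC hi.ne, ((SimpleGraph.sdiff_adj ..).1 hi).2⟩

lemma IsAltCycle.exists_neighbors {F K : SimpleGraph (Fin n)} {k : ℕ}
    {Q : Fin (2 * k + 1 + 1) → Fin n} (hQ : IsAltCycle K (F \ K) Q) (j : Fin (2 * k + 1 + 1)) :
    ∃ y z, K.Adj (Q j) y ∧ (F \ K).Adj (Q j) z ∧
      ∀ t, (closedWalkGraph Q).Adj (Q j) t ↔ t = y ∨ t = z := by
  have h₁ := hQ.2 j
  have h₂ := hQ.2 (j - 1)
  have hp := val_add_one_mod_two (j - 1)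
  rw [sub_add_cancel] at h₂ hp
  by_cases h : (j : ℕ) % 2 = 0
  · rw [if_pos h] at h₁
    rw [if_neg (by omega)] at h₂
    refine ⟨_, _, h₁, h₂.symm, fun t => ?_⟩
    rw [closedWalkGraph_adj hQ.1]
    refine and_iff_right_of_imp ?_
    rintro (rfl | rfl)
    exacts [h₁.ne, h₂.ne']
  · rw [if_neg h] at h₁
    rw [if_pos (by omega)] at h₂
    refine ⟨_, _, h₂.symm, h₁, fun t => ?_⟩
    rw [closedWalkGraph_adj hQ.1, or_comm]
    refine and_iff_right_of_imp ?_
    rintro (rfl | rfl)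
    exacts [h₂.ne', h₁.ne]

lemma IsAltCycle.symmDiff_le {F K : SimpleGraph (Fin n)} {k : ℕ}
    {Q : Fin (2 * k + 1 + 1) → Fin n} (hQ : IsAltCycle K (F \ K) Q) (hKF : K ≤ F) :
    symmDiff K (closedWalkGraph Q) ≤ F := by
  intro x y h
  rw [symmDiff_adj] at h
  rcases h with h | h
  · exact hKF h.1
  · obtain ⟨j, rfl⟩ := closedWalkGraph_adj_exists h.1
    obtain ⟨u, w, hu, hw, ht⟩ := hQ.exists_neighbors j
    rcases (ht y).1 h.1 with rfl | rfl
    exacts [hKF hu, ((SimpleGraph.sdiff_adj ..).1 hw).1]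

lemma IsAltCycle.deg_symmDiff {F K : SimpleGraph (Fin n)} {k : ℕ}
    {Q : Fin (2 * k + 1 + 1) → Fin n} (hQ : IsAltCycle K (F \ K) Q) (x : Fin n) :
    deg (symmDiff K (closedWalkGraph Q)) x = deg K x := by
  by_cases hx : ∃ j, Q j = x
  · obtain ⟨j, rfl⟩ := hx
    obtain ⟨y, z, hy, hz, ht⟩ := hQ.exists_neighbors j
    have hz' := ((SimpleGraph.sdiff_adj ..).1 hz).2
    have hset : (symmDiff K (closedWalkGraph Q)).neighborSet (Q j) =
        insert z (K.neighborSet (Q j) \ {y}) := by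
      ext t
      simp only [SimpleGraph.mem_neighborSet, symmDiff_adj, ht, Set.mem_insert_iff, Set.mem_sdiff,
        Set.mem_singleton_iff]
      by_cases h₁ : t = y
      · subst h₁
        have : t ≠ z := fun h => hz' (h ▸ hy)
        tauto
      · by_cases h₂ : t = z
        · subst h₂
          tauto
        · tauto
    simp only [deg, Nat.card_coe_set_eq]
    rw [hset, Set.ncard_insert_of_notMem (fun h => hz' h.1),
      Set.ncard_sdiff_singleton_add_one (show y ∈ K.neighborSet (Q j) from hy)]
  · have hset : (symmDiff K (closedWalkGraph Q)).neighborSet x = K.neighborSet x := by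
      ext t
      have : ¬ (closedWalkGraph Q).Adj x t := fun h => hx (closedWalkGraph_adj_exists h)
      simp only [SimpleGraph.mem_neighborSet, symmDiff_adj]
      tauto
    rw [deg, deg, hset]

/-- An alternating path closed up through a further vertex is an alternating cycle. -/
lemma IsAltSeq.isAltCycle_cons {G₁ G₂ : SimpleGraph (Fin n)} {k : ℕ}
    {P : Fin (2 * k + 1) → Fin n} (hP : IsAltSeq G₁ G₂ (2 * k) P) {a : Fin n}
    (ha : ∀ i, P i ≠ a) (h₀ : G₂.Adj a (P 0)) (h₁ : G₁.Adj (P (Fin.last _)) a) :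
    IsAltCycle G₂ G₁ (Fin.cons a P : Fin (2 * k + 1 + 1) → Fin n) := by
  refine ⟨Fin.cons_injective_iff.2 ⟨by rintro ⟨i, hi⟩; exact ha i hi, hP.1⟩, fun i => ?_⟩
  induction i using Fin.cases with
  | zero =>
    have h01 : (0 + 1 : Fin (2 * k + 1 + 1)) = Fin.succ 0 := by simp
    rw [h01]
    simpa using h₀
  | succ i =>
    induction i using Fin.lastCases with
    | last =>
      rw [if_neg (by simp), Fin.succ_last, Fin.last_add_one]
      simpa [← Fin.succ_last] using h₁
    | cast i =>
      have hi := hP.2 i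
      have hs : (i.castSucc.succ + 1 : Fin (2 * k + 1 + 1)) = i.succ.succ := by
        rw [Fin.succ_castSucc, Fin.coeSucc_eq_succ]
      rw [hs]
      simp only [Fin.cons_succ, Fin.val_succ, Fin.val_castSucc]
      split_ifs at hi ⊢ <;> first | exact hi | omega

/-- Deleting a vertex from an alternating cycle and reversing leaves an alternating path. -/
lemma IsAltCycle.isAltSeq_rev {G₁ G₂ : SimpleGraph (Fin n)} {k : ℕ}
    {P : Fin (2 * k + 1) → Fin n} {a : Fin n}
    (h : IsAltCycle G₁ G₂ (Fin.cons a P : Fin (2 * k + 1 + 1) → Fin n)) :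
    IsAltSeq G₁ G₂ (2 * k) (P ∘ Fin.rev) := by
  refine ⟨(Fin.cons_injective_iff.1 h.1).2.comp Fin.rev_injective, fun i => ?_⟩
  have hi := h.2 i.rev.castSucc.succ
  have hs : (i.rev.castSucc.succ + 1 : Fin (2 * k + 1 + 1)) = i.rev.succ.succ := by
    rw [Fin.succ_castSucc, Fin.coeSucc_eq_succ]
  rw [hs] at hi
  simp only [Fin.cons_succ, Fin.val_succ, Fin.val_castSucc, Fin.val_rev] at hi
  simp only [Function.comp, Fin.rev_castSucc, Fin.rev_succ]
  have := i.isLt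
  split_ifs at hi ⊢ <;> first | exact hi.symm | omega

/-- The set `𝒦_d(F)` of `d`-regular subgraphs of `F`. -/
def regularSubgraphs (F : SimpleGraph (Fin n)) (d : ℕ) : Finset (SimpleGraph (Fin n)) :=
  Finset.univ.filter fun K => IsRegularGraph K d ∧ K ≤ F

lemma mem_regularSubgraphs {F K : SimpleGraph (Fin n)} {d : ℕ} :
    K ∈ regularSubgraphs F d ↔ IsRegularGraph K d ∧ K ≤ F := by
  simp [regularSubgraphs]

/-- The alternating paths counted by `altPathCount`. -/
def altPaths (G₁ G₂ : SimpleGraph (Fin n)) (k : ℕ) (x y : Fin n) (Z : Set (Fin n)) :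
    Finset (Fin (k + 1) → Fin n) :=
  Finset.univ.filter fun P => IsAltSeq G₁ G₂ k P ∧ P 0 = x ∧ P (Fin.last k) = y ∧
    ∀ i : Fin (k + 1), i ≠ 0 → i ≠ Fin.last k → P i ∉ Z

lemma mem_altPaths {G₁ G₂ : SimpleGraph (Fin n)} {k : ℕ} {x y : Fin n} {Z : Set (Fin n)}
    {P : Fin (k + 1) → Fin n} :
    P ∈ altPaths G₁ G₂ k x y Z ↔ IsAltSeq G₁ G₂ k P ∧ P 0 = x ∧ P (Fin.last k) = y ∧
      ∀ i : Fin (k + 1), i ≠ 0 → i ≠ Fin.last k → P i ∉ Z := by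
  simp [altPaths]

lemma card_altPaths (G₁ G₂ : SimpleGraph (Fin n)) (k : ℕ) (x y : Fin n) (Z : Set (Fin n)) :
    (altPaths G₁ G₂ k x y Z).card = altPathCount G₁ G₂ k x y Z := by
  rw [altPathCount, Nat.card_eq_fintype_card, Fintype.card_subtype, altPaths]

/-- Double counting the switchings that remove the edge `ab` and insert the edge `av`. -/
lemma sum_altPathCount_le (F : SimpleGraph (Fin n)) (d k : ℕ) {a b v : Fin n}
    (hab : F.Adj a b) (hav : F.Adj a v) :
    ∑ K ∈ (regularSubgraphs F d).filter (fun K => K.Adj a b ∧ ¬ K.Adj a v),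
        altPathCount (F \ K) K (2 * k) b v {a} ≤
      ∑ K ∈ (regularSubgraphs F d).filter (fun K => K.Adj a v ∧ ¬ K.Adj a b),
        altPathCount (F \ K) K (2 * k) v b ∅ := by
  simp only [← card_altPaths]
  rw [← Finset.card_sigma, ← Finset.card_sigma]
  have key : ∀ K : SimpleGraph (Fin n), ∀ P : Fin (2 * k + 1) → Fin n, K.Adj a b → ¬ K.Adj a v →
      P ∈ altPaths (F \ K) K (2 * k) b v {a} →
      IsAltCycle K (F \ K) (Fin.cons a P : Fin (2 * k + 1 + 1) → Fin n) := by
    intro K P hKb hKv hP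
    obtain ⟨hP, h0, hl, hZ⟩ := mem_altPaths.1 hP
    refine hP.isAltCycle_cons (fun i hi => ?_) (by rwa [h0]) ?_
    · by_cases hi0 : i = 0
      · rw [hi0, h0] at hi
        exact hab.ne hi.symm
      · by_cases hil : i = Fin.last _
        · rw [hil, hl] at hi
          exact hav.ne hi.symm
        · exact hZ i hi0 hil hi
    · rw [hl, SimpleGraph.sdiff_adj]
      exact ⟨hav.symm, fun h => hKv h.symm⟩
  refine Finset.card_le_card_of_injOn
    (fun p => ⟨symmDiff p.1 (closedWalkGraph (Fin.cons a p.2 : Fin (2 * k + 1 + 1) → Fin n)),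
      p.2 ∘ Fin.rev⟩) ?_ ?_
  · rintro ⟨K, P⟩ hp
    simp only [Finset.coe_sigma, Set.mem_sigma_iff, Finset.mem_coe, Finset.mem_filter,
      mem_regularSubgraphs] at hp ⊢
    obtain ⟨⟨⟨hreg, hKF⟩, hKb, hKv⟩, hP⟩ := hp
    have hQ := key K P hKb hKv hP
    have hQ' := hQ.switch hKF
    obtain ⟨-, h0, hl, -⟩ := mem_altPaths.1 hP
    refine ⟨⟨⟨fun x => (hQ.deg_symmDiff x).trans (hreg x), hQ.symmDiff_le hKF⟩, ?_, ?_⟩, ?_⟩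
    · have h := hQ'.2 (Fin.last _)
      rw [if_neg (by simp), Fin.last_add_one, ← Fin.succ_last, Fin.cons_succ, hl,
        Fin.cons_zero] at h
      exact h.symm
    · have h := hQ'.2 0
      have h01 : (0 + 1 : Fin (2 * k + 1 + 1)) = Fin.succ 0 := by simp
      rw [if_pos (by simp), h01, Fin.cons_succ, h0, Fin.cons_zero] at h
      exact ((SimpleGraph.sdiff_adj ..).1 h).2
    · refine mem_altPaths.2 ⟨hQ'.isAltSeq_rev, ?_, ?_, ?_⟩
      · simpa using hl
      · simpa using h0
      · simp
  · rintro ⟨K, P⟩ - ⟨K', P'⟩ - h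
    obtain ⟨h₁, h₂⟩ := Sigma.mk.inj h
    have h₂ : P = P' := Fin.rev_surjective.injective_comp_right (eq_of_heq h₂)
    subst h₂
    have h₁ : K = K' := symmDiff_left_injective _ h₁
    rw [h₁]

lemma card_walks_le (r : ℕ → Fin n → Fin n → Prop) (D : ℕ → ℝ)
    (hD : ∀ i x, (Nat.card {y // r i x y} : ℝ) ≤ D i) (x : Fin n) (k : ℕ) :
    (Nat.card {P : Fin (k + 1) → Fin n // P 0 = x ∧
      ∀ i : Fin k, r i (P i.castSucc) (P i.succ)} : ℝ) ≤ ∏ i ∈ Finset.range k, D i := by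
  induction k with
  | zero =>
    have : Subsingleton {P : Fin (0 + 1) → Fin n // P 0 = x ∧
        ∀ i : Fin 0, r i (P i.castSucc) (P i.succ)} := by
      refine ⟨fun P P' => Subtype.ext (funext fun i => ?_)⟩
      rw [Fin.fin_one_eq_zero i, P.2.1, P'.2.1]
    simpa using Finite.card_le_one_iff_subsingleton.2 this
  | succ k ih =>
    set S := {P : Fin (k + 1) → Fin n // P 0 = x ∧ ∀ i : Fin k, r i (P i.castSucc) (P i.succ)}
    let g : {P : Fin (k + 1 + 1) → Fin n // P 0 = x ∧
        ∀ i : Fin (k + 1), r i (P i.castSucc) (P i.succ)} →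
        Σ P : S, {y // r k (P.1 (Fin.last k)) y} := fun P =>
      ⟨⟨Fin.init P.1, P.2.1, fun i => P.2.2 i.castSucc⟩,
        ⟨P.1 (Fin.last _), P.2.2 (Fin.last k)⟩⟩
    have hg : Function.Injective g := by
      intro P P' h
      have h₁ : Fin.init P.1 = Fin.init P'.1 := congrArg (fun q => q.1.1) h
      have h₂ : P.1 (Fin.last _) = P'.1 (Fin.last _) := congrArg (fun q => q.2.1) h
      rw [Subtype.ext_iff, ← Fin.snoc_init_self P.1, ← Fin.snoc_init_self P'.1, h₁, h₂]
    have hD₀ : 0 ≤ D k := (Nat.cast_nonneg _).trans (hD k x)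
    calc _ ≤ (Nat.card (Σ P : S, {y // r k (P.1 (Fin.last k)) y}) : ℝ) := by
          exact_mod_cast Nat.card_le_card_of_injective g hg
      _ = ∑ P : S, (Nat.card {y // r k (P.1 (Fin.last k)) y} : ℝ) := by
          rw [Nat.card_sigma]
          push_cast
          rfl
      _ ≤ ∑ _P : S, D k := Finset.sum_le_sum fun P _ => hD k _
      _ = (Nat.card S : ℝ) * D k := by simp [Nat.card_eq_fintype_card]
      _ ≤ _ := by
          rw [Finset.prod_range_succ]
          exact mul_le_mul_of_nonneg_right ih hD₀

lemma altPathCount_le_pow {G₁ G₂ : SimpleGraph (Fin n)} {D₁ D₂ : ℝ}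
    (h₁ : ∀ x, (deg G₁ x : ℝ) ≤ D₁) (h₂ : ∀ x, (deg G₂ x : ℝ) ≤ D₂) (k : ℕ) (x y : Fin n)
    (Z : Set (Fin n)) : (altPathCount G₁ G₂ (2 * k) x y Z : ℝ) ≤ (D₁ * D₂) ^ k := by
  have hw := card_walks_le (fun i u w => if i % 2 = 0 then G₁.Adj u w else G₂.Adj u w)
    (fun i => if i % 2 = 0 then D₁ else D₂)
    (fun i u => by
      by_cases hi : i % 2 = 0
      · simp only [if_pos hi]
        exact h₁ u
      · simp only [if_neg hi]
        exact h₂ u) x (2 * k)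
  have hprod : ∏ i ∈ Finset.range (2 * k), (if i % 2 = 0 then D₁ else D₂) = (D₁ * D₂) ^ k := by
    clear hw
    induction k with
    | zero => simp
    | succ k ih =>
      rw [show 2 * (k + 1) = 2 * k + 1 + 1 by ring, Finset.prod_range_succ, Finset.prod_range_succ,
        ih, if_pos (by omega), if_neg (by omega), pow_succ, mul_assoc]
  rw [hprod] at hw
  refine le_trans ?_ hw
  rw [altPathCount]
  exact Nat.cast_le.2 <| Nat.card_mono (Set.toFinite {P : Fin (2 * k + 1) → Fin n | P 0 = x ∧
    ∀ i : Fin (2 * k), if (i : ℕ) % 2 = 0 then G₁.Adj (P i.castSucc) (P i.succ)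
      else G₂.Adj (P i.castSucc) (P i.succ)}) fun P
      (hP : IsAltSeq G₁ G₂ (2 * k) P ∧ P 0 = x ∧ _) => ⟨hP.2.1, hP.1.2⟩

lemma deg_sdiff {F K : SimpleGraph (Fin n)} (h : K ≤ F) (x : Fin n) :
    (deg (F \ K) x : ℝ) = deg F x - deg K x := by
  have hs : (F \ K).neighborSet x = F.neighborSet x \ K.neighborSet x := by
    ext t
    simp
  have := Set.ncard_sdiff_add_ncard_of_subset (s := K.neighborSet x) (t := F.neighborSet x)
    (fun t ht => h ht)
  rw [← hs] at this
  simp only [deg, Nat.card_coe_set_eq]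
  rw [← this]
  push_cast
  ring

/-- The number of `d`-regular subgraphs of `F` in which `x` and `y` are adjacent. -/
def adjCount (F : SimpleGraph (Fin n)) (d : ℕ) (x y : Fin n) : ℕ :=
  ((regularSubgraphs F d).filter fun K => K.Adj x y).card

lemma deg_eq_card_filter (G : SimpleGraph (Fin n)) (a : Fin n) :
    deg G a = (Finset.univ.filter fun v => G.Adj a v).card := by
  rw [deg, Nat.card_eq_fintype_card, ← Fintype.card_subtype]
  rfl

lemma sum_adjCount (F : SimpleGraph (Fin n)) (d : ℕ) (a : Fin n) :
    ∑ v ∈ Finset.univ.filter (fun v => F.Adj a v), adjCount F d a v =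
      (regularSubgraphs F d).card * d := by
  simp only [adjCount, Finset.card_filter]
  rw [Finset.sum_comm]
  rw [Finset.sum_const_nat]
  intro K hK
  rw [mem_regularSubgraphs] at hK
  rw [← Finset.card_filter, Finset.filter_filter, ← hK.1 a, deg_eq_card_filter]
  congr 1
  ext v
  simp only [Finset.mem_filter]
  exact and_congr_right fun _ => and_iff_right_of_imp fun h => hK.2 h

lemma mul_adjCount_le {F : SimpleGraph (Fin n)} {d k : ℕ} {a b v : Fin n} {X α β M : ℝ}
    (bad : Finset (SimpleGraph (Fin n)))
    (hab : F.Adj a b) (hav : F.Adj a v) (hX : 0 < X) (hα₀ : 0 ≤ α) (hα : α ≤ 1) (hβ : 1 ≤ β)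
    (hM : 0 ≤ M)
    (hlow : ∀ K ∈ regularSubgraphs F d, K ∉ bad → b ≠ v →
      α * X ≤ altPathCount (F \ K) K (2 * k) b v {a})
    (hupp : ∀ K ∈ regularSubgraphs F d, K ∉ bad → b ≠ v →
      (altPathCount (F \ K) K (2 * k) v b ∅ : ℝ) ≤ β * X)
    (hcrude : ∀ K ∈ regularSubgraphs F d,
      (altPathCount (F \ K) K (2 * k) v b ∅ : ℝ) ≤ M * X) :
    α * adjCount F d a b ≤ β * adjCount F d a v + (M + 1) * bad.card := by
  have hbad : (0 : ℝ) ≤ (M + 1) * bad.card := by positivity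
  rcases eq_or_ne b v with rfl | hbv
  · have : (0 : ℝ) ≤ adjCount F d a b := Nat.cast_nonneg _
    nlinarith
  set A := (regularSubgraphs F d).filter fun K => K.Adj a b ∧ ¬ K.Adj a v with hA
  set B := (regularSubgraphs F d).filter fun K => K.Adj a v ∧ ¬ K.Adj a b with hB
  set I := (regularSubgraphs F d).filter fun K => K.Adj a b ∧ K.Adj a v with hI
  have hAI : adjCount F d a b = A.card + I.card := by
    rw [adjCount, ← Finset.card_filter_add_card_filter_not (fun K => K.Adj a v),
      Finset.filter_filter, Finset.filter_filter, add_comm]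
  have hBI : adjCount F d a v = B.card + I.card := by
    rw [adjCount, ← Finset.card_filter_add_card_filter_not (fun K => K.Adj a b),
      Finset.filter_filter, Finset.filter_filter, add_comm]
    exact congrArg₂ _ rfl (congrArg _ (Finset.filter_congr fun K _ => and_comm))
  have hswitch : ∑ K ∈ A, (altPathCount (F \ K) K (2 * k) b v {a} : ℝ) ≤
      ∑ K ∈ B, (altPathCount (F \ K) K (2 * k) v b ∅ : ℝ) := by
    exact_mod_cast sum_altPathCount_le F d k hab hav
  have hlower : (α * A.card - bad.card) * X ≤
      ∑ K ∈ A, (altPathCount (F \ K) K (2 * k) b v {a} : ℝ) := by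
    calc (α * A.card - bad.card) * X ≤ ((A \ bad).card) * (α * X) := by
          have h : (A.card : ℝ) ≤ (A \ bad).card + bad.card := by
            exact_mod_cast Finset.card_le_card_sdiff_add_card
          have hc : (0 : ℝ) ≤ bad.card := Nat.cast_nonneg _
          have : α * A.card - bad.card ≤ (A \ bad).card * α := by nlinarith
          rw [← mul_assoc]
          exact mul_le_mul_of_nonneg_right this hX.le
      _ = ∑ _K ∈ A \ bad, α * X := by simp
      _ ≤ ∑ K ∈ A \ bad, (altPathCount (F \ K) K (2 * k) b v {a} : ℝ) := by
          refine Finset.sum_le_sum fun K hK => ?_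
          rw [Finset.mem_sdiff] at hK
          exact hlow K (Finset.mem_filter.1 hK.1).1 hK.2 hbv
      _ ≤ _ := Finset.sum_le_sum_of_subset_of_nonneg Finset.sdiff_subset
          fun _ _ _ => Nat.cast_nonneg _
  have hupper : ∑ K ∈ B, (altPathCount (F \ K) K (2 * k) v b ∅ : ℝ) ≤
      (β * B.card + M * bad.card) * X := by
    rw [← Finset.sum_inter_add_sum_sdiff B bad]
    have h₁ : ∑ K ∈ B ∩ bad, (altPathCount (F \ K) K (2 * k) v b ∅ : ℝ) ≤ bad.card * (M * X) := by
      calc _ ≤ ∑ _K ∈ B ∩ bad, M * X := Finset.sum_le_sum fun K hK =>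
            hcrude K (Finset.mem_filter.1 (Finset.mem_inter.1 hK).1).1
        _ = ((B ∩ bad).card : ℝ) * (M * X) := by simp
        _ ≤ _ := by gcongr; exact Finset.inter_subset_right
    have h₂ : ∑ K ∈ B \ bad, (altPathCount (F \ K) K (2 * k) v b ∅ : ℝ) ≤ B.card * (β * X) := by
      calc _ ≤ ∑ _K ∈ B \ bad, β * X := Finset.sum_le_sum fun K hK => by
            rw [Finset.mem_sdiff] at hK
            exact hupp K (Finset.mem_filter.1 hK.1).1 hK.2 hbv
        _ = ((B \ bad).card : ℝ) * (β * X) := by simp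
        _ ≤ _ := by gcongr; exact Finset.sdiff_subset
    linarith
  have hAB : α * A.card - bad.card ≤ β * B.card + M * bad.card :=
    le_of_mul_le_mul_right (hlower.trans (hswitch.trans hupper)) hX
  have : (0 : ℝ) ≤ I.card := Nat.cast_nonneg _
  rw [hAI, hBI]
  push_cast
  nlinarith

/-- If all edges at `a` are about equally likely to lie in a random `d`-regular subgraph, then each
of them does with probability about `d / deg F a`. -/
lemma deg_mul_adjCount_bounds {F : SimpleGraph (Fin n)} {d : ℕ} {a : Fin n} {α β ε : ℝ}
    (h : ∀ b v, F.Adj a b → F.Adj a v → α * adjCount F d a b ≤ β * adjCount F d a v + ε)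
    {b : Fin n} (hab : F.Adj a b) :
    α * (deg F a * adjCount F d a b) ≤ β * ((regularSubgraphs F d).card * d) + deg F a * ε ∧
      α * ((regularSubgraphs F d).card * d) ≤ β * (deg F a * adjCount F d a b) + deg F a * ε := by
  have hs : ((regularSubgraphs F d).card * d : ℝ) =
      ∑ v ∈ Finset.univ.filter (fun v => F.Adj a v), (adjCount F d a v : ℝ) := by
    exact_mod_cast (sum_adjCount F d a).symm
  have hc : (deg F a : ℝ) = ∑ v ∈ Finset.univ.filter (fun v => F.Adj a v), (1 : ℝ) := by
    simp [deg_eq_card_filter]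
  rw [hs, hc]
  simp only [Finset.sum_mul, Finset.mul_sum, ← Finset.sum_add_distrib, one_mul]
  exact ⟨Finset.sum_le_sum fun v hv => h b v hab (Finset.mem_filter.1 hv).2,
    Finset.sum_le_sum fun v hv => h v b (Finset.mem_filter.1 hv).2 hab⟩

lemma one_add_pow_le {η : ℝ} {k : ℕ} (hη₀ : 0 ≤ η) (hη : η ≤ 1 / 10) (hn : 0 < n)
    (hk : (k : ℝ) ≤ 10 * Real.log n) : (1 + η) ^ k ≤ n := by
  have hn' : (0 : ℝ) < n := Nat.cast_pos.2 hn
  calc (1 + η) ^ k ≤ Real.exp η ^ k := by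
        gcongr
        linarith [Real.add_one_le_exp η]
    _ = Real.exp (k * η) := (Real.exp_nat_mul η k).symm
    _ ≤ Real.exp (Real.log n) := by
        gcongr
        nlinarith [Nat.cast_nonneg (α := ℝ) k]
    _ = n := Real.exp_log hn'

lemma ncard_mem_edgeSet (F : SimpleGraph (Fin n)) (d : ℕ) (x y : Fin n) :
    {K : SimpleGraph (Fin n) | (IsRegularGraph K d ∧ K ≤ F) ∧ s(x, y) ∈ K.edgeSet}.ncard =
      adjCount F d x y := by
  rw [adjCount, ← Set.ncard_coe_finset]
  congr 1
  ext K
  simp [mem_regularSubgraphs]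

lemma le_of_degree_bounds {η Ea Eu D D' T : ℝ} (hη : 0 < η) (hηc : η ≤ 1 / 100) (hD : 0 < D)
    (hEu : 0 ≤ Eu) (hDD : (1 - η) * D' ≤ (1 + η) * D)
    (h₁ : (1 - 1.02 * η) * (D * Ea) ≤ (1 + 1.02 * η) * T)
    (h₂ : (1 - 1.04 * η) * T ≤ (1 + η) * (D' * Eu)) : Ea ≤ (1 + 40 * η) * Eu := by
  have h₃ : (1 - η) * (D' * Eu) ≤ (1 + η) * (D * Eu) := by
    rw [← mul_assoc, ← mul_assoc]
    exact mul_le_mul_of_nonneg_right hDD hEu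
  have hη₁ : 0 < 1 - 1.02 * η := by linarith
  have hη₂ : 0 < 1 - 1.04 * η := by linarith
  have hη₃ : 0 < 1 - η := by linarith
  have hpoly : (1 + 1.02 * η) * (1 + η) * (1 + η) ≤
      (1 + 40 * η) * ((1 - η) * (1 - 1.04 * η) * (1 - 1.02 * η)) := by
    have hη₄ : 0.9 ≤ (1 - η) * (1 - 1.04 * η) * (1 - 1.02 * η) ∧
        1 - 4 * η ≤ (1 - η) * (1 - 1.04 * η) * (1 - 1.02 * η) := by
      constructor <;> nlinarith [mul_nonneg hη.le hη.le, mul_nonneg hη.le (sub_nonneg.2 hηc),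
        mul_nonneg (mul_nonneg hη.le hη.le) (sub_nonneg.2 hηc)]
    have hη₅ : (1 + 1.02 * η) * (1 + η) * (1 + η) ≤ 1 + 4 * η := by
      nlinarith [mul_nonneg hη.le (sub_nonneg.2 hηc),
        mul_nonneg (mul_nonneg hη.le hη.le) (sub_nonneg.2 hηc)]
    nlinarith [hη₄.1, hη₄.2, mul_le_mul_of_nonneg_left hη₄.1 hη.le]
  refine le_of_mul_le_mul_left (a := (1 - η) * (1 - 1.04 * η) * (1 - 1.02 * η) * D) ?_
    (by positivity)
  calc (1 - η) * (1 - 1.04 * η) * (1 - 1.02 * η) * D * Ea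
      = (1 - η) * (1 - 1.04 * η) * ((1 - 1.02 * η) * (D * Ea)) := by ring
    _ ≤ (1 - η) * (1 - 1.04 * η) * ((1 + 1.02 * η) * (T)) := by gcongr
    _ = (1 - η) * (1 + 1.02 * η) * ((1 - 1.04 * η) * (T)) := by ring
    _ ≤ (1 - η) * (1 + 1.02 * η) * ((1 + η) * (D' * Eu)) := by gcongr
    _ = (1 + 1.02 * η) * (1 + η) * ((1 - η) * (D' * Eu)) := by ring
    _ ≤ (1 + 1.02 * η) * (1 + η) * ((1 + η) * (D * Eu)) := by gcongr
    _ = (1 + 1.02 * η) * (1 + η) * (1 + η) * (D * Eu) := by ring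
    _ ≤ (1 + 40 * η) * ((1 - η) * (1 - 1.04 * η) * (1 - 1.02 * η)) * (D * Eu) := by gcongr
    _ = _ := by ring

/-- **Theorem 4.1 (the main switching argument).** There is an absolute constant `c* > 0`
such that: given `d ∈ [n]`, `δ > 0`, `η, C₀` with `0 < η ≤ c*`, `0 < 1/C₀ ≤ c*`, `η·d ≥ C₀`
and `η²·δ ≥ C₀·log n`, an integer `4 ≤ ℓ ≤ 10 log n`, and a graph `F` on `[n]` with
`𝒦_d(F) ≠ ∅`, if (A1) every degree of `F` is `d + (1±η)δ`, and for all but at most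
`n⁻⁶·|𝒦_d(F)|` graphs `K ∈ 𝒦_d(F)` both (A2) and (A3) hold, then for all edges `e, f` of
`F`: `|{K ∈ 𝒦_d(F) : e ∈ E(K)}| ≤ (1+40η)·|{K ∈ 𝒦_d(F) : f ∈ E(K)}|`. -/
theorem switching_argument :
    ∃ cstar : ℝ, 0 < cstar ∧
      ∀ n d : ℕ, ∀ δ η C₀ : ℝ,
        1 ≤ d → d ≤ n → 0 < δ → 0 < η → η ≤ cstar → 0 < C₀ → 1 / C₀ ≤ cstar →
        C₀ ≤ η * d → C₀ * Real.log n ≤ η ^ 2 * δ →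
        ∀ ℓ : ℕ, 4 ≤ ℓ → (ℓ : ℝ) ≤ 10 * Real.log n →
          ∀ F : SimpleGraph (Fin n),
            {K : SimpleGraph (Fin n) | IsRegularGraph K d ∧ K ≤ F}.Nonempty →
            (∀ v, (d : ℝ) + (1 - η) * δ ≤ (deg F v : ℝ) ∧
              (deg F v : ℝ) ≤ (d : ℝ) + (1 + η) * δ) →
            (({K : SimpleGraph (Fin n) | (IsRegularGraph K d ∧ K ≤ F) ∧
                ¬ ((∀ x y : Fin n, x ≠ y → ∀ Z : Set (Fin n), Z.ncard ≤ 4 * ℓ →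
                      (1 - η - (((Z ∪ {x}) ∩ K.neighborSet y).ncard : ℝ) / d) *
                          (d : ℝ) ^ ℓ * δ ^ ℓ / n ≤
                        (altPathCount (F \ K) K (2 * ℓ) x y Z : ℝ)) ∧
                    (∀ x y : Fin n, x ≠ y →
                      (altPathCount (F \ K) K (2 * ℓ) x y ∅ : ℝ) ≤
                        (1 + η) * (d : ℝ) ^ ℓ * δ ^ ℓ / n))}.ncard : ℝ) ≤
              ((n : ℝ) ^ 6)⁻¹ *
                ({K : SimpleGraph (Fin n) | IsRegularGraph K d ∧ K ≤ F}.ncard : ℝ)) →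
            ∀ e ∈ F.edgeSet, ∀ f ∈ F.edgeSet,
              ({K : SimpleGraph (Fin n) | (IsRegularGraph K d ∧ K ≤ F) ∧
                  e ∈ K.edgeSet}.ncard : ℝ) ≤
                (1 + 40 * η) *
                  ({K : SimpleGraph (Fin n) | (IsRegularGraph K d ∧ K ≤ F) ∧
                    f ∈ K.edgeSet}.ncard : ℝ) := by
  refine ⟨1 / 100, by norm_num, ?_⟩
  intro n d δ η C₀ hd hdn hδ hη hηc hC₀ hC₀c hηd _ ℓ _ hℓn F _ hdeg hbad e he f hf
  have hn : 0 < n := hd.trans hdn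
  have hn₁ : (1 : ℝ) ≤ n := Nat.one_le_cast.2 hn
  have hd₁ : (1 : ℝ) ≤ d := Nat.one_le_cast.2 hd
  have hdn' : (d : ℝ) ≤ n := Nat.cast_le.2 hdn
  have hC₀' : 100 ≤ C₀ := by
    rw [div_le_iff₀ hC₀] at hC₀c
    linarith
  have hηd' : 100 ≤ η * d := hC₀'.trans hηd
  have hd2 : 2 / (d : ℝ) ≤ 0.02 * η := by
    rw [div_le_iff₀ (by linarith)]
    linarith
  set X : ℝ := (d : ℝ) ^ ℓ * δ ^ ℓ / n with hXdef
  have hX : 0 < X := by positivity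
  set bad := (regularSubgraphs F d).filter fun K =>
    ¬ ((∀ x y : Fin n, x ≠ y → ∀ Z : Set (Fin n), Z.ncard ≤ 4 * ℓ →
        (1 - η - (((Z ∪ {x}) ∩ K.neighborSet y).ncard : ℝ) / d) * (d : ℝ) ^ ℓ * δ ^ ℓ / n ≤
          (altPathCount (F \ K) K (2 * ℓ) x y Z : ℝ)) ∧
      (∀ x y : Fin n, x ≠ y →
        (altPathCount (F \ K) K (2 * ℓ) x y ∅ : ℝ) ≤ (1 + η) * (d : ℝ) ^ ℓ * δ ^ ℓ / n))
    with hbaddef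
  set N : ℝ := ((regularSubgraphs F d).card : ℝ) with hN
  have hbadcard : (bad.card : ℝ) ≤ ((n : ℝ) ^ 6)⁻¹ * N := by
    rw [hN, ← Set.ncard_coe_finset bad, ← Set.ncard_coe_finset (regularSubgraphs F d)]
    convert hbad using 4
    · ext K
      rw [hbaddef, Finset.mem_coe, Finset.mem_filter, mem_regularSubgraphs]
      rfl
    · ext K
      exact mem_regularSubgraphs
  have hgood : ∀ K ∈ regularSubgraphs F d, K ∉ bad → _ := fun K hK h =>
    not_not.1 fun h' => h (Finset.mem_filter.2 ⟨hK, h'⟩)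
  have hpair : ∀ a b v, F.Adj a b → F.Adj a v → (1 - 1.02 * η) * adjCount F d a b ≤
      (1 + η) * adjCount F d a v + ((n : ℝ) ^ 2 + 1) * bad.card := by
    intro a b v hab hav
    refine mul_adjCount_le (k := ℓ) bad hab hav hX (by linarith) (by linarith) (by linarith)
      (by positivity) ?_ ?_ ?_
    · intro K hK hKbad hbv
      refine le_trans ?_ ((hgood K hK hKbad).1 b v hbv {a} (by rw [Set.ncard_singleton]; omega))
      have hc : ((({a} ∪ {b} : Set (Fin n)) ∩ K.neighborSet v).ncard : ℝ) / d ≤ 0.02 * η := by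
        refine le_trans (div_le_div_of_nonneg_right ?_ (by linarith)) hd2
        have h₁ := Set.ncard_inter_le_ncard_left ({a} ∪ {b} : Set (Fin n)) (K.neighborSet v)
        have h₂ := Set.ncard_union_le ({a} : Set (Fin n)) {b}
        rw [Set.ncard_singleton, Set.ncard_singleton] at h₂
        exact_mod_cast h₁.trans h₂
      rw [mul_assoc, mul_div_assoc]
      exact mul_le_mul_of_nonneg_right (by linarith) hX.le
    · intro K hK hKbad hbv
      have := (hgood K hK hKbad).2 v b hbv.symm
      rwa [mul_assoc, mul_div_assoc] at this
    · intro K hK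
      rw [mem_regularSubgraphs] at hK
      have h := altPathCount_le_pow (G₁ := F \ K) (G₂ := K) (D₁ := (1 + η) * δ) (D₂ := d)
        (fun x => by rw [deg_sdiff hK.2, hK.1 x]; linarith [(hdeg x).2])
        (fun x => by rw [hK.1 x]) ℓ v b ∅
      refine h.trans ?_
      calc ((1 + η) * δ * d) ^ ℓ = (1 + η) ^ ℓ * n * X := by
            rw [hXdef, mul_pow, mul_pow]
            field_simp
        _ ≤ n * n * X := by
            gcongr
            exact one_add_pow_le hη.le (by linarith) hn hℓn
        _ = n ^ 2 * X := by ring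
  have hNnn : 0 ≤ N := Nat.cast_nonneg _
  have herr : ∀ a, (deg F a : ℝ) * (((n : ℝ) ^ 2 + 1) * bad.card) ≤ 0.02 * η * (N * d) := by
    intro a
    have hda : (deg F a : ℝ) ≤ n := by
      rw [deg_eq_card_filter]
      exact_mod_cast (Finset.card_filter_le _ _).trans_eq (by simp)
    calc (deg F a : ℝ) * (((n : ℝ) ^ 2 + 1) * bad.card)
        ≤ n * ((n ^ 2 + n ^ 2) * (((n : ℝ) ^ 6)⁻¹ * N)) := by
          gcongr
          nlinarith
      _ = 2 / (n : ℝ) ^ 3 * N := by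
          field_simp
          ring
      _ ≤ 0.02 * η * d * N := by
          refine mul_le_mul_of_nonneg_right ?_ hNnn
          have hn3 : (1 : ℝ) ≤ (n : ℝ) ^ 3 := one_le_pow₀ hn₁
          rw [div_le_iff₀ (by positivity)]
          nlinarith
      _ = _ := by ring
  induction e using Sym2.ind with | _ a b
  induction f using Sym2.ind with | _ u w
  rw [ncard_mem_edgeSet, ncard_mem_edgeSet]
  have hupper := (deg_mul_adjCount_bounds (hpair a) he).1
  have hlower := (deg_mul_adjCount_bounds (hpair u) hf).2
  have ha := hdeg a
  have hu := hdeg u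
  have herr₁ := herr a
  have herr₂ := herr u
  rw [← hN] at hupper hlower
  set Ea : ℝ := (adjCount F d a b : ℝ)
  set Eu : ℝ := (adjCount F d u w : ℝ)
  have hEu : 0 ≤ Eu := Nat.cast_nonneg _
  set D : ℝ := (deg F a : ℝ)
  set D' : ℝ := (deg F u : ℝ)
  have hD : 0 < D := by nlinarith
  have hDD : (1 - η) * D' ≤ (1 + η) * D := by nlinarith
  have h₁ : (1 - 1.02 * η) * (D * Ea) ≤ (1 + 1.02 * η) * (N * d) := by linarith
  have h₂ : (1 - 1.04 * η) * (N * d) ≤ (1 + η) * (D' * Eu) := by linarith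
  exact le_of_degree_bounds hη hηc hD hEu hDD h₁ h₂

end Sandwich
end
end

section
/- There is c* > 0 such that for every ε ∈ (0,1] and all σ, μ ∈ (0, c*] there is C > 0 such that for every c > 0 there is n₀ ∈ ℕ with the following property for all n ≥ n₀. Let d ∈ [n] with d ≥ C·log n, let m be an integer with ε·d·n/2 ≤ m ≤ n^{1+σ}, set δ = 2m/n, λ = max{μ²/(log n)², (n·log n/m)^{1/4}} and p = m·(binom(n,2) − dn/2)^{−1}. Then for every K ∈ 𝒦_d(n), if E is formed by including each element of [n]^(2)∖E(K) independently with probability p and F = K + E, then with probability at least 1 − c·n^{−14}: for every integer ℓ with 1 ≤ ℓ ≤ 10·log n and every v ∈ [n], the number of (F∖K, K)-alternating paths of length 2ℓ starting at v is at most (1+30λ)·d^ℓ·δ^ℓ. (Lemma 5.1.) -/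
open scoped Classical ENNReal

noncomputable section

namespace Sandwich

variable {n : ℕ}

/-- The total weight of all walks with `k` steps starting at a vertex, where the `i`-th step
from `u` to `w` has weight `g i u w`. -/
def walkWeight {α : Type*} [Fintype α] : (ℕ → α → α → ℝ) → ℕ → α → ℝ
  | _, 0, _ => 1
  | g, k + 1, v => ∑ u, g 0 v u * walkWeight (fun i => g (i + 1)) k u

lemma sum_prod_eq_walkWeight {α : Type*} [Fintype α] (k : ℕ) :
    ∀ (g : ℕ → α → α → ℝ) (v : α),
      (∑ P : Fin (k + 1) → α,
        if P 0 = v then ∏ i : Fin k, g i (P i.castSucc) (P i.succ) else 0) =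
        walkWeight g k v := by
  induction k with
  | zero =>
    intro g v
    rw [← (Equiv.funUnique (Fin 1) α).symm.sum_comp]
    simp [walkWeight]
  | succ k ih =>
    intro g v
    rw [walkWeight, ← (Fin.consEquiv (fun _ : Fin (k + 2) => α)).sum_comp,
      Fintype.sum_prod_type]
    simp only [Fin.consEquiv, Equiv.coe_fn_mk, Fin.cons_zero]
    rw [Finset.sum_eq_single v]
    · simp only [if_true, Fin.prod_univ_succ, Fin.castSucc_zero, Fin.cons_zero, Fin.cons_succ,
        ← Fin.succ_castSucc, Fin.val_zero, Fin.val_succ]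
      simp only [← ih, Finset.mul_sum]
      rw [Finset.sum_comm]
      refine Finset.sum_congr rfl fun P _ => ?_
      rw [Finset.sum_eq_single (P 0)]
      · simp
      · intro b _ hb
        simp [hb.symm]
      · simp
    · intro b _ hb
      simp [hb]
    · simp

/-- Step weights for alternating walks: even steps have weight `p` (or `1` along an edge of `S`),
odd steps follow edges of `K`. -/
def altStep (K : SimpleGraph (Fin n)) (S : Finset (Sym2 (Fin n))) (p : ℝ) (i : ℕ)
    (u w : Fin n) : ℝ :=
  if i % 2 = 0 then (if s(u, w) ∈ S then 1 else p) else (if K.Adj u w then 1 else 0)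

/-- The vertices joined to `u` by an element of `S`. -/
def nbrs (S : Finset (Sym2 (Fin n))) (u : Fin n) : Finset (Fin n) :=
  Finset.univ.filter fun w => s(u, w) ∈ S

/-- The vertices incident with an element of `S`. -/
def touched (S : Finset (Sym2 (Fin n))) : Finset (Fin n) :=
  Finset.univ.filter fun u => (nbrs S u).Nonempty

lemma sum_adj_eq {K : SimpleGraph (Fin n)} {d : ℕ} (hK : IsRegularGraph K d) (u : Fin n) :
    (∑ w, if K.Adj u w then (1 : ℝ) else 0) = d := by
  have h := hK u
  rw [Finset.sum_boole, ← h, deg, Nat.card_eq_fintype_card, Fintype.card_subtype]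
  simp [SimpleGraph.mem_neighborSet]

lemma walkWeight_altStep_le {K : SimpleGraph (Fin n)} {d : ℕ} (hK : IsRegularGraph K d)
    (S : Finset (Sym2 (Fin n))) {p θ D a h : ℝ} (hp : 0 ≤ p) (hθ : 0 ≤ θ) (hD : 0 ≤ D)
    (hdeg : ∀ u, ((nbrs S u).card : ℝ) ≤ a) (ht : ((touched S).card : ℝ) ≤ h)
    (h1 : p * (n + θ * h) ≤ D) (h2 : a * (1 + θ) ≤ D * θ) (i : ℕ) :
    ∀ u, walkWeight (altStep K S p) (2 * i) u ≤
      (D * d) ^ i * (1 + θ * if u ∈ touched S then 1 else 0) := by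
  induction i with
  | zero =>
    intro u
    simp only [walkWeight, pow_zero, one_mul]
    split_ifs <;> simp [hθ]
  | succ i ih =>
    intro u
    set M := (D * d) ^ i with hM
    have hM0 : 0 ≤ M := by positivity
    have hshift : (fun j => altStep K S p (j + 1 + 1)) = altStep K S p := by
      funext j x y
      simp [altStep, Nat.add_assoc]
    have hexp : walkWeight (altStep K S p) (2 * (i + 1)) u =
        ∑ x, altStep K S p 0 u x * ∑ y, altStep K S p 1 x y *
          walkWeight (altStep K S p) (2 * i) y := by
      rw [show 2 * (i + 1) = 2 * i + 1 + 1 by ring]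
      simp only [walkWeight, hshift, zero_add]
    set T : Fin n → ℝ := fun y => 1 + θ * if y ∈ touched S then 1 else 0 with hT
    have hT0 : ∀ y, 0 ≤ T y := fun y => by simp only [hT]; (split_ifs <;> simp); linarith
    have hT1 : ∀ y, T y ≤ 1 + θ := fun y => by simp only [hT]; split_ifs <;> simp [hθ]
    set κ : Fin n → Fin n → ℝ := fun x y => if K.Adj x y then 1 else 0 with hκ
    have hκ0 : ∀ x y, 0 ≤ κ x y := fun x y => by simp only [hκ]; split_ifs <;> simp
    have hinner : ∀ x, ∑ y, κ x y * (M * T y) ≤ d * (M * (1 + θ)) := by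
      intro x
      rw [← sum_adj_eq hK x, Finset.sum_mul]
      refine Finset.sum_le_sum fun y _ => ?_
      exact mul_le_mul_of_nonneg_left (mul_le_mul_of_nonneg_left (hT1 y) hM0) (hκ0 x y)
    have hcol : ∑ x, ∑ y, κ x y * (M * T y) = d * M * ∑ y, T y := by
      rw [Finset.sum_comm, Finset.mul_sum]
      refine Finset.sum_congr rfl fun y _ => ?_
      rw [← Finset.sum_mul]
      have : ∑ x, κ x y = d := by
        rw [← sum_adj_eq hK y]
        refine Finset.sum_congr rfl fun x _ => ?_
        simp only [hκ, K.adj_comm]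
      rw [this]
      ring
    have hTsum : ∑ y, T y ≤ n + θ * h := by
      simp only [hT, Finset.sum_add_distrib, ← Finset.mul_sum]
      have : (∑ y, if y ∈ touched S then (1 : ℝ) else 0) = (touched S).card := by simp
      rw [this]
      simp only [Finset.sum_const, Finset.card_univ, Fintype.card_fin, nsmul_eq_mul, mul_one]
      gcongr
    have hSpart : (∑ x, if s(u, x) ∈ S then (1 : ℝ) else 0) ≤
        a * if u ∈ touched S then 1 else 0 := by
      rw [Finset.sum_boole]
      by_cases hu : u ∈ touched S
      · simpa [hu, nbrs] using hdeg u
      · have : nbrs S u = ∅ := by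
          simpa [touched, Finset.not_nonempty_iff_eq_empty] using hu
        rw [show Finset.univ.filter (fun x => s(u, x) ∈ S) = ∅ from this]
        simp [hu]
    calc walkWeight (altStep K S p) (2 * (i + 1)) u
        = ∑ x, (if s(u, x) ∈ S then 1 else p) * ∑ y, κ x y *
          walkWeight (altStep K S p) (2 * i) y := by
            rw [hexp]; simp [altStep, hκ]
      _ ≤ ∑ x, (p + if s(u, x) ∈ S then 1 else 0) * ∑ y, κ x y * (M * T y) := by
            refine Finset.sum_le_sum fun x _ => ?_
            have e1 : ∑ y, κ x y * walkWeight (altStep K S p) (2 * i) y ≤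
                ∑ y, κ x y * (M * T y) :=
              Finset.sum_le_sum fun y _ => mul_le_mul_of_nonneg_left (ih y) (hκ0 x y)
            have e2 : 0 ≤ ∑ y, κ x y * (M * T y) :=
              Finset.sum_nonneg fun y _ => mul_nonneg (hκ0 x y) (mul_nonneg hM0 (hT0 y))
            split_ifs
            · nlinarith
            · nlinarith
      _ = p * (d * M * ∑ y, T y) +
          ∑ x, (if s(u, x) ∈ S then 1 else 0) * ∑ y, κ x y * (M * T y) := by
            simp only [add_mul, Finset.sum_add_distrib, ← Finset.mul_sum, hcol]
      _ ≤ p * (d * M * (n + θ * h)) +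
          ∑ x, (if s(u, x) ∈ S then 1 else 0) * (d * (M * (1 + θ))) := by
            refine add_le_add (by gcongr) (Finset.sum_le_sum fun x _ => ?_)
            exact mul_le_mul_of_nonneg_left (hinner x) (by split_ifs <;> simp)
      _ ≤ d * M * (p * (n + θ * h)) +
          (a * if u ∈ touched S then 1 else 0) * (d * (M * (1 + θ))) := by
            rw [← Finset.sum_mul]
            refine add_le_add (le_of_eq (by ring)) ?_
            exact mul_le_mul_of_nonneg_right hSpart (by positivity)
      _ ≤ (D * d) ^ (i + 1) * (1 + θ * if u ∈ touched S then 1 else 0) := by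
            rw [pow_succ, ← hM]
            have hdM : 0 ≤ (d : ℝ) * M := by positivity
            have e1 := mul_le_mul_of_nonneg_left h1 hdM
            have e2 := mul_le_mul_of_nonneg_left h2 hdM
            split_ifs
            · nlinarith
            · nlinarith

/-- The set of pairs used by the even steps of the sequence `P`. -/
def evenEdges {k : ℕ} (P : Fin (k + 1) → Fin n) : Finset (Sym2 (Fin n)) :=
  (Finset.univ.filter fun i : Fin k => (i : ℕ) % 2 = 0).image fun i => s(P i.castSucc, P i.succ)

/-- The sequences starting at `v` which are alternating paths as soon as their even steps are
edges of the first graph. -/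
def candidates (K : SimpleGraph (Fin n)) (k : ℕ) (v : Fin n) :
    Finset (Fin (k + 1) → Fin n) :=
  Finset.univ.filter fun P => Function.Injective P ∧ P 0 = v ∧
    ∀ i : Fin k, if (i : ℕ) % 2 = 0 then ¬ K.Adj (P i.castSucc) (P i.succ)
      else K.Adj (P i.castSucc) (P i.succ)

lemma altStartCount_eq_sum (F K : SimpleGraph (Fin n)) (k : ℕ) (v : Fin n) :
    (altStartCount (F \ K) K k v : ℝ) =
      ∑ P ∈ candidates K k v, if (evenEdges P : Set (Sym2 (Fin n))) ⊆ F.edgeSet then 1 else 0 := by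
  rw [altStartCount, Nat.card_eq_fintype_card, Fintype.card_subtype, Finset.sum_boole,
    candidates, Finset.filter_filter]
  refine congrArg (fun s : Finset (Fin (k + 1) → Fin n) => (s.card : ℝ)) ?_
  ext P
  rw [Finset.mem_filter, Finset.mem_filter]
  simp only [Finset.mem_univ, true_and, IsAltSeq, evenEdges]
  constructor
  · rintro ⟨⟨hinj, h⟩, h0⟩
    refine ⟨⟨hinj, h0, fun i => ?_⟩, ?_⟩
    · have := h i
      split_ifs with hi
      · rw [if_pos hi, SimpleGraph.sdiff_adj] at this
        exact this.2
      · rwa [if_neg hi] at this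
    · intro e he
      simp only [Finset.coe_image, Set.mem_image, Finset.coe_filter, Finset.mem_univ,
        true_and, Set.mem_ofPred_eq] at he
      obtain ⟨i, hi, rfl⟩ := he
      have := h i
      rw [if_pos hi, SimpleGraph.sdiff_adj] at this
      exact this.1
  · rintro ⟨⟨hinj, h0, h⟩, hsub⟩
    refine ⟨⟨hinj, fun i => ?_⟩, h0⟩
    have := h i
    split_ifs with hi
    · rw [if_pos hi] at this
      rw [SimpleGraph.sdiff_adj]
      refine ⟨?_, this⟩
      have hm : s(P i.castSucc, P i.succ) ∈ F.edgeSet := hsub (by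
        simp only [Finset.coe_image, Set.mem_image, Finset.coe_filter, Finset.mem_univ,
          true_and, Set.mem_ofPred_eq]
        exact ⟨i, hi, rfl⟩)
      exact hm
    · rwa [if_neg hi] at this

lemma pow_card_sdiff_eq (K : SimpleGraph (Fin n)) (S : Finset (Sym2 (Fin n))) (p : ℝ) {k : ℕ}
    {v : Fin n} {P : Fin (k + 1) → Fin n} (hP : P ∈ candidates K k v) :
    p ^ (evenEdges P \ S).card =
      ∏ i : Fin k, altStep K S p i (P i.castSucc) (P i.succ) := by
  simp only [candidates, Finset.mem_filter, Finset.mem_univ, true_and] at hP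
  obtain ⟨hinj, -, h⟩ := hP
  have e1 : ∏ i : Fin k, altStep K S p i (P i.castSucc) (P i.succ) =
      ∏ i ∈ Finset.univ.filter (fun i : Fin k => (i : ℕ) % 2 = 0),
        (if s(P i.castSucc, P i.succ) ∈ S then 1 else p) := by
    rw [Finset.prod_filter]
    refine Finset.prod_congr rfl fun i _ => ?_
    have := h i
    by_cases hi : (i : ℕ) % 2 = 0
    · simp [altStep, hi]
    · rw [if_neg hi] at this
      simp [altStep, hi, this]
  rw [e1, ← Finset.prod_image (s := Finset.univ.filter (fun i : Fin k => (i : ℕ) % 2 = 0))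
    (g := fun i => s(P i.castSucc, P i.succ)) (f := fun e => if e ∈ S then (1 : ℝ) else p)]
  · rw [← evenEdges, Finset.prod_ite, Finset.prod_const_one, one_mul, Finset.prod_const,
      Finset.sdiff_eq_filter]
  · intro i _ j _ hij
    simp only [Sym2.eq_iff, hinj.eq_iff, Fin.ext_iff, Fin.val_castSucc, Fin.val_succ] at hij
    ext
    omega

lemma sum_pow_card_sdiff_le (K : SimpleGraph (Fin n)) (S : Finset (Sym2 (Fin n))) {p : ℝ}
    (hp : 0 ≤ p) (k : ℕ) (v : Fin n) :
    ∑ P ∈ candidates K k v, p ^ (evenEdges P \ S).card ≤ walkWeight (altStep K S p) k v := by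
  have hnn : ∀ i u w, 0 ≤ altStep K S p i u w := by
    intro i u w
    simp only [altStep]
    split_ifs <;> simp [hp]
  rw [← sum_prod_eq_walkWeight]
  calc ∑ P ∈ candidates K k v, p ^ (evenEdges P \ S).card
      = ∑ P ∈ candidates K k v, ∏ i : Fin k, altStep K S p i (P i.castSucc) (P i.succ) :=
        Finset.sum_congr rfl fun P hP => pow_card_sdiff_eq K S p hP
    _ ≤ ∑ P ∈ Finset.univ.filter (fun P : Fin (k + 1) → Fin n => P 0 = v),
          ∏ i : Fin k, altStep K S p i (P i.castSucc) (P i.succ) := by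
        refine Finset.sum_le_sum_of_subset_of_nonneg ?_
          fun P _ _ => Finset.prod_nonneg fun i _ => hnn _ _ _
        intro P hP
        simp only [candidates, Finset.mem_filter, Finset.mem_univ, true_and] at hP ⊢
        exact hP.2.1
    _ = _ := by
        rw [Finset.sum_filter]
        refine Finset.sum_congr rfl fun P _ => ?_
        split_ifs <;> rfl

/-- `S` avoids loops and edges of `K`, has maximum degree at most `a` and touches at most
`(k + 1) a` vertices. -/
def IsSparse (K : SimpleGraph (Fin n)) (k a : ℕ) (S : Finset (Sym2 (Fin n))) : Prop :=
  (∀ e ∈ S, e ∉ K.edgeSet ∧ ¬ e.IsDiag) ∧ (∀ u, (nbrs S u).card ≤ a) ∧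
    (touched S).card ≤ (k + 1) * a

lemma nbrs_union (S T : Finset (Sym2 (Fin n))) (u : Fin n) :
    nbrs (S ∪ T) u = nbrs S u ∪ nbrs T u := by
  ext w
  simp [nbrs]

lemma touched_union (S T : Finset (Sym2 (Fin n))) :
    touched (S ∪ T) = touched S ∪ touched T := by
  ext u
  simp [touched, nbrs_union, Finset.union_nonempty]

lemma isSparse_evenEdges {K : SimpleGraph (Fin n)} {k : ℕ} {v : Fin n}
    {P : Fin (k + 1) → Fin n} (hP : P ∈ candidates K k v) : IsSparse K k 1 (evenEdges P) := by
  simp only [candidates, Finset.mem_filter, Finset.mem_univ, true_and] at hP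
  obtain ⟨hinj, -, h⟩ := hP
  have hmem : ∀ e, e ∈ evenEdges P ↔
      ∃ i : Fin k, (i : ℕ) % 2 = 0 ∧ s(P i.castSucc, P i.succ) = e := by
    intro e
    simp [evenEdges]
  refine ⟨?_, ?_, ?_⟩
  · intro e he
    obtain ⟨i, hi, rfl⟩ := (hmem e).1 he
    have := h i
    rw [if_pos hi] at this
    refine ⟨this, ?_⟩
    rw [Sym2.mk_isDiag_iff, hinj.eq_iff, Fin.ext_iff]
    simp
  · intro u
    rw [Finset.card_le_one]
    intro w hw w' hw'
    simp only [nbrs, Finset.mem_filter, Finset.mem_univ, true_and, hmem, Sym2.eq_iff] at hw hw'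
    obtain ⟨i, hi, hi'⟩ := hw
    obtain ⟨j, hj, hj'⟩ := hw'
    have key : ∀ a b : Fin (k + 1), P a = P b → (a : ℕ) = b := fun a b hab => by
      rw [hinj hab]
    have hij : i = j := by
      rcases hi' with ⟨x1, x2⟩ | ⟨x1, x2⟩ <;> rcases hj' with ⟨y1, y2⟩ | ⟨y1, y2⟩
      · have := key _ _ (x1.trans y1.symm)
        simp at this; exact Fin.ext this
      · have := key _ _ (x1.trans y2.symm)
        simp at this; omega
      · have := key _ _ (x2.trans y1.symm)
        simp at this; omega
      · have := key _ _ (x2.trans y2.symm)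
        simp at this; exact Fin.ext this
    subst hij
    rcases hi' with ⟨x1, x2⟩ | ⟨x1, x2⟩ <;> rcases hj' with ⟨y1, y2⟩ | ⟨y1, y2⟩
    · exact x2.symm.trans y2
    · have := key _ _ (x1.trans y2.symm)
      simp at this
    · have := key _ _ (x2.trans y1.symm)
      simp at this
    · exact x1.symm.trans y1
  · have hsub : touched (evenEdges P) ⊆ Finset.univ.image P := by
      intro u hu
      simp only [touched, nbrs, Finset.mem_filter, Finset.mem_univ, true_and,
        Finset.Nonempty, hmem, Sym2.eq_iff] at hu
      obtain ⟨w, i, -, hi⟩ := hu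
      rcases hi with ⟨x1, -⟩ | ⟨-, x2⟩
      · exact Finset.mem_image.2 ⟨_, Finset.mem_univ _, x1⟩
      · exact Finset.mem_image.2 ⟨_, Finset.mem_univ _, x2⟩
    calc (touched (evenEdges P)).card ≤ (Finset.univ.image P).card := Finset.card_le_card hsub
      _ ≤ (Finset.univ : Finset (Fin (k + 1))).card := Finset.card_image_le
      _ = (k + 1) * 1 := by simp

lemma IsSparse.union {K : SimpleGraph (Fin n)} {k a b : ℕ} {S T : Finset (Sym2 (Fin n))}
    (hS : IsSparse K k a S) (hT : IsSparse K k b T) : IsSparse K k (a + b) (S ∪ T) := by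
  refine ⟨?_, fun u => ?_, ?_⟩
  · intro e he
    rcases Finset.mem_union.1 he with he | he
    · exact hS.1 e he
    · exact hT.1 e he
  · rw [nbrs_union]
    exact (Finset.card_union_le _ _).trans (add_le_add (hS.2.1 u) (hT.2.1 u))
  · rw [touched_union, mul_add]
    exact (Finset.card_union_le _ _).trans (add_le_add hS.2.2 hT.2.2)

/-- Moment bound for sums of indicators of alternating paths: if conditioning on any sparse set of
edges leaves the expected number of paths at most `B`, then the `j`-th moment is at most `B ^ j`. -/
lemma moment_le (K : SimpleGraph (Fin n)) {k r : ℕ} {v : Fin n} {p B : ℝ} (hp : 0 ≤ p)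
    (hB : 0 ≤ B) (w : SimpleGraph (Fin n) → ℝ)
    (hw : ∀ T : Finset (Sym2 (Fin n)), (∀ e ∈ T, e ∉ K.edgeSet ∧ ¬ e.IsDiag) →
      ∑ F, w F * (if (T : Set (Sym2 (Fin n))) ⊆ F.edgeSet then 1 else 0) ≤ p ^ T.card)
    (hS : ∀ S, IsSparse K k r S →
      ∑ P ∈ candidates K k v, p ^ (evenEdges P \ S).card ≤ B) (j : ℕ) :
    ∀ a S, a + j ≤ r → IsSparse K k a S →
      ∑ F, w F * ((if (S : Set (Sym2 (Fin n))) ⊆ F.edgeSet then 1 else 0) *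
        (altStartCount (F \ K) K k v : ℝ) ^ j) ≤ p ^ S.card * B ^ j := by
  induction j with
  | zero =>
    intro a S _ hs
    simpa using hw S hs.1
  | succ j ih =>
    intro a S haj hs
    have hmono : IsSparse K k r S :=
      ⟨hs.1, fun u => (hs.2.1 u).trans (by omega),
        hs.2.2.trans (Nat.mul_le_mul_left _ (by omega))⟩
    calc ∑ F, w F * ((if (S : Set (Sym2 (Fin n))) ⊆ F.edgeSet then 1 else 0) *
          (altStartCount (F \ K) K k v : ℝ) ^ (j + 1))
        = ∑ P ∈ candidates K k v, ∑ F, w F *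
          ((if ((S ∪ evenEdges P : Finset (Sym2 (Fin n))) : Set (Sym2 (Fin n))) ⊆ F.edgeSet
            then 1 else 0) * (altStartCount (F \ K) K k v : ℝ) ^ j) := by
          rw [Finset.sum_comm]
          refine Finset.sum_congr rfl fun F _ => ?_
          have hsum : ∑ P ∈ candidates K k v,
              (if ((S ∪ evenEdges P : Finset (Sym2 (Fin n))) : Set (Sym2 (Fin n))) ⊆ F.edgeSet
                then (1 : ℝ) else 0) =
              (if (S : Set (Sym2 (Fin n))) ⊆ F.edgeSet then 1 else 0) *
                (altStartCount (F \ K) K k v : ℝ) := by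
            rw [altStartCount_eq_sum, Finset.mul_sum]
            refine Finset.sum_congr rfl fun P _ => ?_
            rw [Finset.coe_union]
            simp only [Set.union_subset_iff]
            split_ifs <;> simp_all
          rw [← Finset.mul_sum, ← Finset.sum_mul, hsum]
          ring
      _ ≤ ∑ P ∈ candidates K k v, p ^ (S ∪ evenEdges P).card * B ^ j :=
          Finset.sum_le_sum fun P hP =>
            ih (a + 1) _ (by omega) (hs.union (isSparse_evenEdges hP))
      _ = p ^ S.card * B ^ j * ∑ P ∈ candidates K k v, p ^ (evenEdges P \ S).card := by
          rw [Finset.mul_sum]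
          refine Finset.sum_congr rfl fun P _ => ?_
          rw [← Finset.union_sdiff_self_eq_union, Finset.card_union_of_disjoint
            Finset.disjoint_sdiff, pow_add]
          ring
      _ ≤ p ^ S.card * B ^ j * B := by
          gcongr
          exact hS S hmono
      _ = p ^ S.card * B ^ (j + 1) := by ring

lemma sum_addGnp_le {K : SimpleGraph (Fin n)} {p : ℝ} (hp0 : 0 ≤ p) (hp1 : p ≤ 1)
    {ρ : PMF (SimpleGraph (Fin n))} (hρ : IsAddGnp ρ K p) (T : Finset (Sym2 (Fin n)))
    (hT : ∀ e ∈ T, e ∉ K.edgeSet ∧ ¬ e.IsDiag) :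
    ∑ F, (ρ F).toReal * (if (T : Set (Sym2 (Fin n))) ⊆ F.edgeSet then 1 else 0) ≤
      p ^ T.card := by
  set N : Finset (Sym2 (Fin n)) := (⊤ : SimpleGraph (Fin n)).edgeFinset \ K.edgeFinset with hN
  have hq : 0 ≤ 1 - p := by linarith
  set g : Sym2 (Fin n) → ℝ := fun e => if e ∈ T then 0 else 1 - p with hg
  have hg0 : ∀ e, 0 ≤ g e := fun e => by simp only [hg]; split_ifs <;> simp [hp1]
  have hTN : T ⊆ N := by
    intro e he
    have := hT e he
    simp [hN, this.1, this.2]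
  have hprod : ∑ A ∈ N.powerset, (∏ _e ∈ A, p) * ∏ e ∈ N \ A, g e = p ^ T.card := by
    rw [← Finset.prod_add, ← Finset.prod_sdiff hTN, ← Finset.prod_const]
    have e1 : ∏ e ∈ N \ T, (p + g e) = 1 := by
      refine Finset.prod_eq_one fun e he => ?_
      simp [hg, (Finset.mem_sdiff.1 he).2]
    have e2 : ∏ e ∈ T, (p + g e) = ∏ _e ∈ T, p := by
      refine Finset.prod_congr rfl fun e he => ?_
      simp [hg, he]
    rw [e1, e2, one_mul]
  set φ : SimpleGraph (Fin n) → Finset (Sym2 (Fin n)) :=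
    fun F => F.edgeFinset \ K.edgeFinset with hφ
  have hNcard : N.card = n.choose 2 - edgeCount K := by
    rw [hN, Finset.card_sdiff_of_subset (SimpleGraph.edgeFinset_mono le_top),
      SimpleGraph.card_edgeFinset_top_eq_card_choose_two, Fintype.card_fin, edgeCount,
      ← SimpleGraph.coe_edgeFinset, Set.ncard_coe_finset]
  have hcount : ∀ F : SimpleGraph (Fin n), edgeCount F = F.edgeFinset.card := fun F => by
    rw [edgeCount, ← SimpleGraph.coe_edgeFinset, Set.ncard_coe_finset]
  have hφN : ∀ F, φ F ⊆ N := fun F =>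
    Finset.sdiff_subset_sdiff (SimpleGraph.edgeFinset_mono le_top) le_rfl
  calc ∑ F, (ρ F).toReal * (if (T : Set (Sym2 (Fin n))) ⊆ F.edgeSet then 1 else 0)
      = ∑ F ∈ Finset.univ.filter (fun F => K ≤ F), (ρ F).toReal *
          (if (T : Set (Sym2 (Fin n))) ⊆ F.edgeSet then 1 else 0) := by
        rw [Finset.sum_filter]
        refine Finset.sum_congr rfl fun F _ => ?_
        by_cases h : K ≤ F
        · simp [h]
        · simp [h, hρ F]
    _ ≤ ∑ F ∈ Finset.univ.filter (fun F => K ≤ F),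
          (∏ _e ∈ φ F, p) * ∏ e ∈ N \ φ F, g e := by
        refine Finset.sum_le_sum fun F hF => ?_
        have hKF : K ≤ F := (Finset.mem_filter.1 hF).2
        split_ifs with hTF
        · have hTφ : T ⊆ φ F := by
            intro e he
            simp only [hφ, Finset.mem_sdiff, SimpleGraph.mem_edgeFinset]
            exact ⟨hTF he, (hT e he).1⟩
          have e1 : ∏ e ∈ N \ φ F, g e = (1 - p) ^ (N \ φ F).card := by
            rw [← Finset.prod_const]
            refine Finset.prod_congr rfl fun e he => ?_
            have : e ∉ T := fun h => (Finset.mem_sdiff.1 he).2 (hTφ h)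
            simp [hg, this]
          have e2 : (φ F).card = edgeCount F - edgeCount K := by
            rw [hcount, hcount, hφ, Finset.card_sdiff_of_subset (SimpleGraph.edgeFinset_mono hKF)]
          have e3 : (N \ φ F).card = n.choose 2 - edgeCount F := by
            have hle : edgeCount K ≤ edgeCount F := by
              rw [hcount, hcount]
              exact Finset.card_le_card (SimpleGraph.edgeFinset_mono hKF)
            rw [Finset.card_sdiff_of_subset (hφN F), e2, hNcard]
            omega
          rw [e1, Finset.prod_const, e2, e3, hρ F, if_pos hKF,
            ENNReal.toReal_ofReal (by positivity), mul_one]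
        · rw [mul_zero]
          exact mul_nonneg (Finset.prod_nonneg fun _ _ => hp0)
            (Finset.prod_nonneg fun e _ => hg0 e)
    _ = ∑ A ∈ (Finset.univ.filter (fun F => K ≤ F)).image φ,
          (∏ _e ∈ A, p) * ∏ e ∈ N \ A, g e := by
        rw [Finset.sum_image]
        intro F hF G hG hFG
        have hKF : K ≤ F := (Finset.mem_filter.1 hF).2
        have hKG : K ≤ G := (Finset.mem_filter.1 hG).2
        rw [← SimpleGraph.edgeFinset_inj,
          ← Finset.sdiff_union_of_subset (SimpleGraph.edgeFinset_mono hKF),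
          ← Finset.sdiff_union_of_subset (SimpleGraph.edgeFinset_mono hKG)]
        exact congrArg (· ∪ K.edgeFinset) hFG
    _ ≤ ∑ A ∈ N.powerset, (∏ _e ∈ A, p) * ∏ e ∈ N \ A, g e := by
        refine Finset.sum_le_sum_of_subset_of_nonneg ?_ fun A _ _ =>
          mul_nonneg (Finset.prod_nonneg fun _ _ => hp0) (Finset.prod_nonneg fun e _ => hg0 e)
        intro A hA
        obtain ⟨F, -, rfl⟩ := Finset.mem_image.1 hA
        exact Finset.mem_powerset.2 (hφN F)
    _ = p ^ T.card := hprod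

lemma tail_le {K : SimpleGraph (Fin n)} {d : ℕ} (hK : IsRegularGraph K d) {p : ℝ} (hp0 : 0 ≤ p)
    (hp1 : p ≤ 1) {ρ : PMF (SimpleGraph (Fin n))} (hρ : IsAddGnp ρ K p) {ℓ r : ℕ} (v : Fin n)
    {θ D x : ℝ} (hθ : 0 ≤ θ) (hD : 0 ≤ D)
    (h1 : p * (n + θ * ((2 * ℓ + 1) * r)) ≤ D) (h2 : r * (1 + θ) ≤ D * θ) (hx : 0 < x) :
    (∑ F, if x < (altStartCount (F \ K) K (2 * ℓ) v : ℝ) then (ρ F).toReal else 0) ≤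
      ((D * d) ^ ℓ * (1 + θ) / x) ^ r := by
  have hB : 0 ≤ (D * d) ^ ℓ * (1 + θ) := by positivity
  have hempty : IsSparse K (2 * ℓ) 0 ∅ := by
    refine ⟨by simp, fun u => by simp [nbrs], by simp [touched, nbrs]⟩
  have hmom := moment_le (k := 2 * ℓ) (v := v) (r := r) K hp0 hB (fun F => (ρ F).toReal)
    (fun T hT => sum_addGnp_le hp0 hp1 hρ T hT) (by
      intro S hS
      refine (sum_pow_card_sdiff_le K S hp0 _ v).trans
        ((walkWeight_altStep_le hK S (a := r) (h := (2 * ℓ + 1) * r) hp0 hθ hD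
          (fun u => by exact_mod_cast hS.2.1 u) (by exact_mod_cast hS.2.2) h1 h2 ℓ v).trans ?_)
      gcongr
      split_ifs <;> simp [hθ]) r 0 ∅ (by simp) hempty
  rw [div_pow, le_div_iff₀ (by positivity), Finset.sum_mul]
  refine le_trans (Finset.sum_le_sum fun F _ => ?_) (hmom.trans (by simp))
  simp only [Finset.coe_empty, Set.empty_subset, if_true, one_mul]
  split_ifs with h
  · gcongr
  · rw [zero_mul]
    positivity

lemma le_prEvent_of_sum_not_le {α : Type*} [Fintype α] (ρ : PMF α) (P : α → Prop) {y : ℝ}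
    (h : (∑ a, if P a then 0 else (ρ a).toReal) ≤ y) :
    ENNReal.ofReal (1 - y) ≤ prEvent ρ P := by
  have hsum : ∑ a, (ρ a).toReal = 1 := by
    rw [← ENNReal.toReal_sum fun a _ => ρ.apply_ne_top a, ← tsum_fintype (L := .unconditional _), ρ.tsum_coe]
    simp
  have hpr : prEvent ρ P = ENNReal.ofReal (∑ a, if P a then (ρ a).toReal else 0) := by
    rw [prEvent, tsum_fintype, ENNReal.ofReal_sum_of_nonneg]
    · refine Finset.sum_congr rfl fun a _ => ?_
      split_ifs
      · rw [ENNReal.ofReal_toReal (ρ.apply_ne_top a)]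
      · simp
    · intro a _
      split_ifs <;> simp
  rw [hpr]
  refine ENNReal.ofReal_le_ofReal ?_
  have : (∑ a, if P a then (ρ a).toReal else 0) + (∑ a, if P a then 0 else (ρ a).toReal) = 1 := by
    rw [← Finset.sum_add_distrib, ← hsum]
    refine Finset.sum_congr rfl fun a _ => ?_
    split_ifs <;> simp
  linarith

lemma eventually_log_pow_le_sqrt (k : ℕ) {η : ℝ} (hη : 0 < η) :
    ∀ᶠ n : ℕ in Filter.atTop, Real.log n ^ k ≤ η * √(n : ℝ) := by
  have h := (isLittleO_log_rpow_rpow_atTop (k : ℝ) (show (0 : ℝ) < 1 / 2 by norm_num)).bound hη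
  filter_upwards [tendsto_natCast_atTop_atTop.eventually h] with n hn
  rw [Real.rpow_natCast, ← Real.sqrt_eq_rpow, Real.norm_of_nonneg (Real.sqrt_nonneg _)] at hn
  exact (le_abs_self _).trans hn

/-- If `D ≤ δ (1 + x)` with `ℓ x ≤ λ` and `θ ≤ λ`, then `(D d)^ℓ (1 + θ)` is smaller than
`(1 + 30 λ) (d δ)^ℓ` by a factor of at least `exp λ`. -/
lemma growth_ratio_le {d ℓ : ℕ} {δ D x θ lam : ℝ} (hd1 : (1 : ℝ) ≤ d) (hδ0 : 0 < δ) (hD0 : 0 ≤ D)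
    (hx0 : 0 ≤ x) (hθ0 : 0 ≤ θ) (hlam0 : 0 < lam) (hθlam : θ ≤ lam) (hlam5 : lam ≤ 1 / 2)
    (hDx : D ≤ δ * (1 + x)) (hℓx : ℓ * x ≤ lam) :
    (D * d) ^ ℓ * (1 + θ) / ((1 + 30 * lam) * (d : ℝ) ^ ℓ * δ ^ ℓ) ≤ Real.exp (-lam) := by
  have hDℓ : D ^ ℓ ≤ δ ^ ℓ * (1 + 2 * lam) := by
    calc D ^ ℓ ≤ (δ * (1 + x)) ^ ℓ := by gcongr
      _ = δ ^ ℓ * (1 + x) ^ ℓ := mul_pow _ _ _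
      _ ≤ δ ^ ℓ * Real.exp x ^ ℓ := by
        gcongr
        linarith [Real.add_one_le_exp x]
      _ = δ ^ ℓ * Real.exp (ℓ * x) := by rw [Real.exp_nat_mul]
      _ ≤ δ ^ ℓ * Real.exp lam := by gcongr
      _ ≤ δ ^ ℓ * (1 + 2 * lam) := by
        gcongr
        have := Real.abs_exp_sub_one_le (x := lam) (by rw [abs_of_pos hlam0]; linarith)
        rw [abs_of_pos hlam0] at this
        linarith [le_abs_self (Real.exp lam - 1)]
  have hexp := Real.add_one_le_exp (-lam)
  have hpoly : (1 + 2 * lam) * (1 + lam) ≤ (1 - lam) * (1 + 30 * lam) := by nlinarith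
  rw [div_le_iff₀ (by positivity), mul_pow]
  calc D ^ ℓ * (d : ℝ) ^ ℓ * (1 + θ)
      ≤ (δ ^ ℓ * (1 + 2 * lam)) * (d : ℝ) ^ ℓ * (1 + lam) := by gcongr
    _ = ((1 + 2 * lam) * (1 + lam)) * ((d : ℝ) ^ ℓ * δ ^ ℓ) := by ring
    _ ≤ ((1 - lam) * (1 + 30 * lam)) * ((d : ℝ) ^ ℓ * δ ^ ℓ) :=
        mul_le_mul_of_nonneg_right hpoly (by positivity)
    _ ≤ (Real.exp (-lam) * (1 + 30 * lam)) * ((d : ℝ) ^ ℓ * δ ^ ℓ) :=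
        mul_le_mul_of_nonneg_right (mul_le_mul_of_nonneg_right (by linarith) (by positivity))
          (by positivity)
    _ = _ := by ring

set_option maxHeartbeats 1000000 in
/-- The numerical estimates: with `r` moments, the tail bound for paths of length `2ℓ` is at most
`n⁻¹⁷`. -/
lemma exists_moment_order {n d m : ℕ} {ε σ μ δ lam p : ℝ} (hε : 0 < ε)
    (hσ : σ ≤ 1 / 2) (hμ : 0 < μ) (hμ' : μ ≤ 1 / 2) (hL : 5 ≤ Real.log n)
    (hL3 : Real.log n ^ 3 ≤ ε * μ ^ 2 / 160 * √(n : ℝ))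
    (hL7 : Real.log n ^ 7 ≤ μ ^ 4 / 21600 * n) (hs : 4 / ε + 2 ≤ √(n : ℝ)) (hs6 : 6 ≤ √(n : ℝ))
    (hd : 1 ≤ d) (hdL : 2000 / ε * Real.log n ≤ d) (hm : ε * d * n / 2 ≤ m)
    (hm' : (m : ℝ) ≤ (n : ℝ) ^ ((1 : ℝ) + σ)) (hδ : δ = 2 * (m : ℝ) / n)
    (hlam : lam = max (μ ^ 2 / (Real.log n) ^ 2)
      (((n : ℝ) * Real.log n / m) ^ ((1 : ℝ) / 4)))
    (hp : p = (m : ℝ) / ((n.choose 2 : ℝ) - d * n / 2)) :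
    0 < lam ∧ 0 < δ ∧ 0 ≤ p ∧ p ≤ 1 ∧ ∃ (r : ℕ) (θ : ℝ), 0 ≤ θ ∧ ∀ ℓ : ℕ, 1 ≤ ℓ →
      (ℓ : ℝ) ≤ 10 * Real.log n → ∃ D : ℝ, 0 ≤ D ∧ p * (n + θ * ((2 * ℓ + 1) * r)) ≤ D ∧
        r * (1 + θ) ≤ D * θ ∧
        ((D * d) ^ ℓ * (1 + θ) / ((1 + 30 * lam) * (d : ℝ) ^ ℓ * δ ^ ℓ)) ^ r ≤
          ((n : ℝ) ^ 17)⁻¹ := by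
  set L := Real.log n with hLdef
  set s := √(n : ℝ) with hsdef
  have hss : s * s = n := Real.mul_self_sqrt (Nat.cast_nonneg n)
  have hn0 : (0 : ℝ) < n := by rw [← hss]; positivity
  have hd1 : (1 : ℝ) ≤ d := by exact_mod_cast hd
  have hm0 : (0 : ℝ) < m := lt_of_lt_of_le (by positivity) hm
  have hδ0 : 0 < δ := by rw [hδ]; positivity
  have hn1 : (1 : ℝ) ≤ n := by rw [← hss]; nlinarith
  have hms : (m : ℝ) ≤ n * s := by
    refine hm'.trans ?_
    rw [Real.rpow_add hn0, Real.rpow_one, hsdef, Real.sqrt_eq_rpow]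
    gcongr
  have hδs : δ ≤ 2 * s := by
    rw [hδ, div_le_iff₀ hn0]
    linarith
  have hds : ε * d ≤ 2 * s := by
    have : (ε * d) * n ≤ (2 * s) * n := by linarith
    exact le_of_mul_le_mul_right this hn0
  have hδL : 2000 * L ≤ δ := by
    have h1 : 2000 * L ≤ ε * d := by
      have := mul_le_mul_of_nonneg_left hdL hε.le
      rwa [← mul_assoc, mul_div_cancel₀ _ hε.ne'] at this
    have h2 := mul_le_mul_of_nonneg_right h1 hn0.le
    rw [hδ, le_div_iff₀ hn0]
    linarith
  have hd4 : (d : ℝ) ≤ 2 * s / ε := by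
    rw [le_div_iff₀ hε]; linarith
  set w : ℝ := n - 1 - d with hw
  have hwn : n / 2 ≤ w := by
    have h1 : (4 / ε + 2) * s ≤ n := by rw [← hss]; gcongr
    have h2 : (4 / ε + 2) * s = 2 * (2 * s / ε) + 2 * s := by ring
    rw [hw]
    linarith
  have hw0 : 0 < w := by linarith
  have hpw : p = δ / w := by
    rw [hp, hδ, Nat.cast_choose_two,
      show (n : ℝ) * (n - 1) / 2 - d * n / 2 = n * w / 2 by rw [hw]; ring]
    field_simp
  have hp0 : 0 ≤ p := by rw [hpw]; positivity
  have hp1 : p ≤ 1 := by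
    have : 6 * s ≤ s * s := by gcongr
    rw [hpw, div_le_one hw0]
    linarith
  have hLL : n * L / m = 2 * L / δ := by rw [hδ]; field_simp
  have hb0 : 0 < 2 * L / δ := by positivity
  have hlam1 : μ ^ 2 / L ^ 2 ≤ lam := hlam ▸ le_max_left _ _
  have hlam0 : 0 < lam := lt_of_lt_of_le (by positivity) hlam1
  have hlam4 : 2 * L / δ ≤ lam ^ 4 := by
    have h1 : (2 * L / δ) ^ ((1 : ℝ) / 4) ≤ lam := by rw [hlam, ← hLL]; exact le_max_right _ _
    have h2 : ((2 * L / δ) ^ ((1 : ℝ) / 4)) ^ 4 = 2 * L / δ := by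
      rw [← Real.rpow_natCast, ← Real.rpow_mul hb0.le]
      norm_num
    rw [← h2]
    gcongr
  have hlam5 : lam ≤ 1 / 5 := by
    rw [hlam]
    refine max_le ?_ ?_
    · rw [div_le_iff₀ (by positivity)]
      nlinarith
    · rw [hLL]
      have h1 : 2 * L / δ ≤ (1 / 5) ^ 4 := by
        rw [div_le_iff₀ hδ0]
        linarith
      calc (2 * L / δ) ^ ((1 : ℝ) / 4) ≤ (((1 : ℝ) / 5) ^ 4) ^ ((1 : ℝ) / 4) := by gcongr
        _ = 1 / 5 := by
          rw [← Real.rpow_natCast, ← Real.rpow_mul (by norm_num)]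
          norm_num
  refine ⟨hlam0, hδ0, hp0, hp1, ⌈17 * L / lam⌉₊, 2 * (⌈17 * L / lam⌉₊ : ℝ) / δ, by positivity, ?_⟩
  intro ℓ hℓ1 hℓ
  set r : ℝ := (⌈17 * L / lam⌉₊ : ℝ) with hr
  have hr1 : 17 * L / lam ≤ r := Nat.le_ceil _
  have hr2 : r ≤ 18 * L / lam := by
    have h1 := Nat.ceil_lt_add_one (show 0 ≤ 17 * L / lam by positivity)
    have h2 : 1 ≤ L / lam := by rw [le_div_iff₀ hlam0]; linarith
    have h3 : 18 * L / lam = 17 * L / lam + L / lam := by ring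
    rw [h3]
    linarith
  have hr0 : 0 ≤ r := by positivity
  set θ : ℝ := 2 * r / δ with hθ
  have hθ0 : 0 ≤ θ := by positivity
  have hθlam : θ ≤ lam := by
    have h1 : r * lam ≤ 18 * L := by rwa [le_div_iff₀ hlam0] at hr2
    have h2 : 2 * L ≤ lam ^ 4 * δ := by rwa [div_le_iff₀ hδ0] at hlam4
    rw [hθ, div_le_iff₀ hδ0]
    have h3 : (2 * r) * lam ≤ (lam * δ) * lam := by
      have h4 : lam ^ 4 ≤ lam ^ 2 * (1 / 5) ^ 2 := by
        rw [show lam ^ 4 = lam ^ 2 * lam ^ 2 by ring]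
        gcongr
      have h5 := mul_le_mul_of_nonneg_right h4 hδ0.le
      have h6 : 0 ≤ lam ^ 2 * δ := by positivity
      linarith
    exact le_of_mul_le_mul_right h3 hlam0
  have hℓ1' : (1 : ℝ) ≤ ℓ := by exact_mod_cast hℓ1
  set D : ℝ := p * (n + θ * ((2 * ℓ + 1) * r)) with hD
  have hD0 : 0 ≤ D := by positivity
  refine ⟨D, hD0, le_rfl, ?_, ?_⟩
  · have h1 : δ ≤ D := by
      rw [hD, hpw, div_mul_eq_mul_div, le_div_iff₀ hw0]
      have : w ≤ n + θ * ((2 * ℓ + 1) * r) := by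
        have : 0 ≤ θ * ((2 * ℓ + 1) * r) := by positivity
        rw [hw]; linarith
      gcongr
    have h2 : δ * θ = 2 * r := by rw [hθ]; field_simp
    calc r * (1 + θ) ≤ r * 2 := by gcongr; linarith
      _ = δ * θ := by rw [h2]; ring
      _ ≤ D * θ := by gcongr
  · set x : ℝ := 2 * (2 * d + 3 * ℓ * r) / n with hx
    have hDx : D ≤ δ * (1 + x) := by
      rw [hD, hpw, div_mul_eq_mul_div, div_le_iff₀ hw0, mul_assoc]
      refine mul_le_mul_of_nonneg_left ?_ hδ0.le
      have h1 : θ * ((2 * ℓ + 1) * r) ≤ 3 * ℓ * r := by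
        calc θ * ((2 * ℓ + 1) * r) ≤ 1 * ((2 * ℓ + ℓ) * r) := by gcongr; linarith
          _ = _ := by ring
      have h2 : 2 * d + 3 * ℓ * r ≤ x * w := by
        calc 2 * d + 3 * ℓ * r = x * (n / 2) := by rw [hx]; field_simp
          _ ≤ x * w := by gcongr
      have h3 : w = n - 1 - d := hw
      linarith
    have hx0 : 0 ≤ x := by positivity
    have hℓx : ℓ * x ≤ lam := by
      have h1 : ℓ * x ≤ 80 * L / (ε * s) + 10800 * L ^ 3 / (lam * n) := by
        calc ℓ * x ≤ (10 * L) * (2 * (2 * (2 * s / ε) + 3 * (10 * L) * (18 * L / lam)) / n) := by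
              rw [hx]; gcongr
          _ = 80 * L / (ε * s) + 10800 * L ^ 3 / (lam * n) := by
              rw [← hss]
              field_simp
              ring
      have h2 : 80 * L / (ε * s) ≤ μ ^ 2 / L ^ 2 / 2 := by
        rw [div_div, div_le_div_iff₀ (by positivity) (by positivity)]
        linarith
      have h3 : 10800 * L ^ 3 / (lam * n) ≤ μ ^ 2 / L ^ 2 / 2 := by
        calc 10800 * L ^ 3 / (lam * n) ≤ 10800 * L ^ 3 / (μ ^ 2 / L ^ 2 * n) := by gcongr
          _ = 10800 * L ^ 5 / (μ ^ 2 * n) := by field_simp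
          _ ≤ μ ^ 2 / L ^ 2 / 2 := by
            rw [div_div, div_le_div_iff₀ (by positivity) (by positivity)]
            linarith
      linarith
    have hratio := growth_ratio_le hd1 hδ0 hD0 hx0 hθ0 hlam0 hθlam (by linarith) hDx hℓx
    calc _ ≤ Real.exp (-lam) ^ ⌈17 * L / lam⌉₊ := by
          gcongr
      _ = Real.exp (-(r * lam)) := by rw [← Real.exp_nat_mul, ← hr]; congr 1; ring
      _ ≤ Real.exp (-(17 * L)) := by
          have : 17 * L ≤ r * lam := by rwa [div_le_iff₀ hlam0] at hr1
          gcongr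
      _ = ((n : ℝ) ^ 17)⁻¹ := by
          rw [Real.exp_neg, show (17 : ℝ) * L = ((17 : ℕ) : ℝ) * L by norm_num,
            Real.exp_nat_mul, hLdef, Real.exp_log hn0]

/-- **Lemma 5.1.** There is `c* > 0` such that for every `ε ∈ (0,1]` and all
`σ, μ ∈ (0,c*]` there is `C > 0` such that for every `c > 0` and all sufficiently large `n`:
for `d ∈ [n]` with `d ≥ C log n`, an integer `m` with `ε d n/2 ≤ m ≤ n^{1+σ}`,
`δ = 2m/n`, `λ = max{μ²/log²n, (n log n/m)^{1/4}}`, `p = m(binom(n,2) − dn/2)⁻¹`, every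
`K ∈ 𝒦_d(n)` and `F = K + E` with `E` including each non-pair of `K` independently with
probability `p`, with probability at least `1 − c n⁻¹⁴`: for every `1 ≤ ℓ ≤ 10 log n` and
every vertex `v`, the number of `(F∖K,K)`-alternating paths of length `2ℓ` starting at `v`
is at most `(1+30λ) d^ℓ δ^ℓ`. -/
theorem upper_bound_paths_from_vertex :
    ∃ cstar : ℝ, 0 < cstar ∧
      ∀ ε : ℝ, 0 < ε → ε ≤ 1 →
        ∀ σ μ : ℝ, 0 < σ → σ ≤ cstar → 0 < μ → μ ≤ cstar →
          ∃ C : ℝ, 0 < C ∧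
            ∀ c : ℝ, 0 < c →
              ∃ n₀ : ℕ, ∀ n : ℕ, n₀ ≤ n →
                ∀ d m : ℕ, 1 ≤ d → d ≤ n → C * Real.log n ≤ (d : ℝ) →
                  ε * d * n / 2 ≤ (m : ℝ) → (m : ℝ) ≤ (n : ℝ) ^ ((1 : ℝ) + σ) →
                  ∀ δ lam p : ℝ, δ = 2 * (m : ℝ) / n →
                    lam = max (μ ^ 2 / (Real.log n) ^ 2)
                      (((n : ℝ) * Real.log n / m) ^ ((1 : ℝ) / 4)) →
                    p = (m : ℝ) / ((n.choose 2 : ℝ) - d * n / 2) →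
                    ∀ K : SimpleGraph (Fin n), IsRegularGraph K d →
                      ∀ ρ : PMF (SimpleGraph (Fin n)), IsAddGnp ρ K p →
                        ENNReal.ofReal (1 - c / (n : ℝ) ^ 14) ≤
                          prEvent ρ (fun F =>
                            ∀ ℓ : ℕ, 1 ≤ ℓ → (ℓ : ℝ) ≤ 10 * Real.log n →
                              ∀ v : Fin n,
                                (altStartCount (F \ K) K (2 * ℓ) v : ℝ) ≤
                                  (1 + 30 * lam) * (d : ℝ) ^ ℓ * δ ^ ℓ) := by
  refine ⟨1 / 2, by norm_num, fun ε hε hε1 σ μ _ hσ hμ hμ' => ⟨2000 / ε, by positivity,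
    fun c hc => ?_⟩⟩
  have hlog : Filter.Tendsto (fun n : ℕ => Real.log n) Filter.atTop Filter.atTop :=
    Real.tendsto_log_atTop.comp tendsto_natCast_atTop_atTop
  have hsqrt : Filter.Tendsto (fun n : ℕ => √(n : ℝ)) Filter.atTop Filter.atTop :=
    Real.tendsto_sqrt_atTop.comp tendsto_natCast_atTop_atTop
  obtain ⟨n₀, hn₀⟩ := Filter.eventually_atTop.1
    ((hlog.eventually_ge_atTop 5).and ((hsqrt.eventually_ge_atTop (4 / ε + 2)).and
      ((eventually_log_pow_le_sqrt 3 (show 0 < ε * μ ^ 2 / 160 by positivity)).and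
        ((eventually_log_pow_le_sqrt 7 (show 0 < μ ^ 4 / 21600 by positivity)).and
          (eventually_log_pow_le_sqrt 1 (show 0 < c / 10 by positivity))))))
  refine ⟨n₀, fun n hn d m hd _ hdL hm hm' δ lam p hδ hlam hp K hK ρ hρ => ?_⟩
  obtain ⟨hL, hs, hL3, hL7, hLc⟩ := hn₀ n hn
  have hs6 : 6 ≤ √(n : ℝ) := by
    have : 4 ≤ 4 / ε := by rw [le_div_iff₀ hε]; linarith
    linarith
  have hss : √(n : ℝ) * √(n : ℝ) = n := Real.mul_self_sqrt (Nat.cast_nonneg n)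
  have hn1 : (1 : ℝ) ≤ n := by nlinarith
  have hsn : √(n : ℝ) ≤ n := by nlinarith
  have hd0 : (0 : ℝ) < d := by exact_mod_cast hd
  obtain ⟨hlam0, hδ0, hp0, hp1, r, θ, hθ, hr⟩ := exists_moment_order hε hσ hμ hμ' hL hL3
    (hL7.trans (by gcongr)) hs hs6 hd hdL hm hm' hδ hlam hp
  refine le_prEvent_of_sum_not_le ρ _ ?_
  set x : ℕ → ℝ := fun ℓ => (1 + 30 * lam) * (d : ℝ) ^ ℓ * δ ^ ℓ with hx
  set I := Finset.Icc 1 ⌊10 * Real.log n⌋₊ with hI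
  have htail : ∀ ℓ ∈ I, ∀ v : Fin n,
      (∑ F, if x ℓ < (altStartCount (F \ K) K (2 * ℓ) v : ℝ) then (ρ F).toReal else 0) ≤
        ((n : ℝ) ^ 17)⁻¹ := by
    intro ℓ hℓ v
    obtain ⟨h1, h2⟩ := Finset.mem_Icc.1 hℓ
    obtain ⟨D, hD, hD1, hD2, hD3⟩ := hr ℓ h1 ((Nat.le_floor_iff (by positivity)).1 h2)
    exact (tail_le hK hp0 hp1 hρ v hθ hD hD1 hD2 (by positivity)).trans hD3
  calc _ ≤ ∑ F, ∑ ℓ ∈ I, ∑ v : Fin n,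
        (if x ℓ < (altStartCount (F \ K) K (2 * ℓ) v : ℝ) then (ρ F).toReal else 0) := by
        refine Finset.sum_le_sum fun F _ => ?_
        have hnn : ∀ ℓ v, 0 ≤ (if x ℓ < (altStartCount (F \ K) K (2 * ℓ) v : ℝ)
            then (ρ F).toReal else 0) := fun ℓ v => by split_ifs <;> simp
        split_ifs with h
        · exact Finset.sum_nonneg fun ℓ _ => Finset.sum_nonneg fun v _ => hnn ℓ v
        · push Not at h
          obtain ⟨ℓ, h1, h2, v, hv⟩ := h
          have hℓ : ℓ ∈ I := Finset.mem_Icc.2 ⟨h1, Nat.le_floor h2⟩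
          calc (ρ F).toReal
              = if x ℓ < (altStartCount (F \ K) K (2 * ℓ) v : ℝ) then (ρ F).toReal else 0 :=
                (if_pos hv).symm
            _ ≤ ∑ v : Fin n,
                (if x ℓ < (altStartCount (F \ K) K (2 * ℓ) v : ℝ) then (ρ F).toReal else 0) :=
                Finset.single_le_sum (f := fun v => if x ℓ < (altStartCount (F \ K) K (2 * ℓ) v : ℝ)
                  then (ρ F).toReal else 0) (fun v _ => hnn ℓ v) (Finset.mem_univ v)
            _ ≤ _ := Finset.single_le_sum (f := fun ℓ => ∑ v : Fin n,
                (if x ℓ < (altStartCount (F \ K) K (2 * ℓ) v : ℝ) then (ρ F).toReal else 0))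
                (fun ℓ _ => Finset.sum_nonneg fun v _ => hnn ℓ v) hℓ
    _ = ∑ ℓ ∈ I, ∑ v : Fin n, ∑ F,
        (if x ℓ < (altStartCount (F \ K) K (2 * ℓ) v : ℝ) then (ρ F).toReal else 0) := by
        rw [Finset.sum_comm]
        exact Finset.sum_congr rfl fun ℓ _ => Finset.sum_comm
    _ ≤ ∑ ℓ ∈ I, ∑ v : Fin n, ((n : ℝ) ^ 17)⁻¹ :=
        Finset.sum_le_sum fun ℓ hℓ => Finset.sum_le_sum fun v _ => htail ℓ hℓ v
    _ = ⌊10 * Real.log n⌋₊ * (n * ((n : ℝ) ^ 17)⁻¹) := by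
        simp [hI]
    _ ≤ (c * n) * (n * ((n : ℝ) ^ 17)⁻¹) := by
        gcongr
        refine (Nat.floor_le (by positivity)).trans ?_
        rw [pow_one] at hLc
        nlinarith
    _ ≤ c / (n : ℝ) ^ 14 := by
        rw [show (c * n) * (n * ((n : ℝ) ^ 17)⁻¹) = c / (n : ℝ) ^ 15 by field_simp]
        gcongr
        norm_num

end Sandwich
end
end

section
/- There is c* > 0 such that for every ε ∈ (0,1], every C' ≥ 1/c* and every σ ∈ (0, c*] there is C > 0 such that for every c > 0 there is n₀ ∈ ℕ with the following property for all n ≥ n₀. Let d satisfy C·log n ≤ d ≤ n−1, let m be an integer with ε·d·n/2 ≤ m ≤ binom(n,2) − dn/2, set δ = 2m/n and p = m·(binom(n,2) − dn/2)^{−1}, let K ∈ 𝒦_d(n), form E by including each element of [n]^(2)∖E(K) independently with probability p, and let F = K + E. Then: (i) with probability at least 1 − c·n^{−14}, for every v ∈ [n], (1 − C'·√(log n/δ))·δ ≤ d_{F∖K}(v) ≤ (1 + C'·√(log n/δ))·δ; and (ii) if moreover d ≤ n^σ and m ≤ n^{1+σ}, then with probability at least 1 − c·n^{−14}, for every v ∈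 [n], (1 − 2/δ)·d_{F∖K}(v)·δ·d ≤ Σ_{u ∈ N_{F∖K}(v)} Σ_{u' ∈ N_K(u)} d_{F∖K}(u') ≤ (1 + 2/δ)·d_{F∖K}(v)·δ·d. (Lemma 5.3.) -/
open scoped Classical ENNReal

noncomputable section

namespace Sandwich

variable {n : ℕ}

section Binomial

variable {α : Type*} [DecidableEq α]

/-- The probability that a `p`-random subset of `M` equals `S`. -/
def subsetWeight (p : ℝ) (M S : Finset α) : ℝ := p ^ S.card * (1 - p) ^ (M \ S).card

/-- The expectation of `f` over a `p`-random subset of `M`. -/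
def subsetExp (p : ℝ) (M : Finset α) (f : Finset α → ℝ) : ℝ :=
  ∑ S ∈ M.powerset, subsetWeight p M S * f S

/-- The probability of `P` for a `p`-random subset of `M`. -/
def subsetPr (p : ℝ) (M : Finset α) (P : Finset α → Prop) : ℝ :=
  subsetExp p M (fun S => if P S then 1 else 0)

lemma subsetExp_prod (p : ℝ) (M : Finset α) (x : α → ℝ) :
    subsetExp p M (fun S => ∏ e ∈ S, x e) = ∏ e ∈ M, (p * x e + (1 - p)) := by
  rw [Finset.prod_add]
  refine Finset.sum_congr rfl fun S _ => ?_
  simp only [subsetWeight, Finset.prod_mul_distrib, Finset.prod_const]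
  ring

variable {p : ℝ}

lemma subsetWeight_nonneg (h₀ : 0 ≤ p) (h₁ : p ≤ 1) (M S : Finset α) :
    0 ≤ subsetWeight p M S :=
  mul_nonneg (pow_nonneg h₀ _) (pow_nonneg (sub_nonneg.2 h₁) _)

lemma subsetExp_mono (h₀ : 0 ≤ p) (h₁ : p ≤ 1) {M : Finset α} {f g : Finset α → ℝ}
    (h : ∀ S ⊆ M, f S ≤ g S) : subsetExp p M f ≤ subsetExp p M g :=
  Finset.sum_le_sum fun S hS =>
    mul_le_mul_of_nonneg_left (h S (Finset.mem_powerset.1 hS)) (subsetWeight_nonneg h₀ h₁ M S)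

lemma subsetExp_one (p : ℝ) (M : Finset α) : subsetExp p M (fun _ => 1) = 1 := by
  simpa using subsetExp_prod p M (fun _ => 1)

lemma subsetExp_add (p : ℝ) (M : Finset α) (f g : Finset α → ℝ) :
    subsetExp p M (fun S => f S + g S) = subsetExp p M f + subsetExp p M g := by
  simp [subsetExp, mul_add, Finset.sum_add_distrib]

lemma subsetExp_mul_const (p : ℝ) (M : Finset α) (f : Finset α → ℝ) (a : ℝ) :
    subsetExp p M (fun S => f S * a) = subsetExp p M f * a := by
  simp [subsetExp, Finset.sum_mul, mul_assoc]

lemma subsetPr_le_subsetExp (h₀ : 0 ≤ p) (h₁ : p ≤ 1) {M : Finset α} {P : Finset α → Prop}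
    {f : Finset α → ℝ} (hf : ∀ S ⊆ M, 0 ≤ f S) (h : ∀ S ⊆ M, P S → 1 ≤ f S) :
    subsetPr p M P ≤ subsetExp p M f := by
  refine subsetExp_mono h₀ h₁ fun S hS => ?_
  split_ifs with hP
  exacts [h S hS hP, hf S hS]

lemma subsetPr_mono (h₀ : 0 ≤ p) (h₁ : p ≤ 1) {M : Finset α} {P Q : Finset α → Prop}
    (h : ∀ S ⊆ M, P S → Q S) : subsetPr p M P ≤ subsetPr p M Q :=
  subsetPr_le_subsetExp h₀ h₁ (fun S _ => by split_ifs <;> norm_num)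
    fun S hS hP => by rw [if_pos (h S hS hP)]

lemma subsetPr_or_le (h₀ : 0 ≤ p) (h₁ : p ≤ 1) (M : Finset α) (P Q : Finset α → Prop) :
    subsetPr p M (fun S => P S ∨ Q S) ≤ subsetPr p M P + subsetPr p M Q := by
  rw [subsetPr, subsetPr, subsetPr, ← subsetExp_add]
  refine subsetExp_mono h₀ h₁ fun S _ => ?_
  by_cases hP : P S <;> by_cases hQ : Q S <;> simp [hP, hQ]

lemma subsetPr_exists_le {ι : Type*} [Fintype ι] (h₀ : 0 ≤ p) (h₁ : p ≤ 1) (M : Finset α)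
    (P : ι → Finset α → Prop) {b : ℝ} (h : ∀ i, subsetPr p M (P i) ≤ b) :
    subsetPr p M (fun S => ∃ i, P i S) ≤ Fintype.card ι * b := by
  have key : subsetPr p M (fun S => ∃ i, P i S) ≤ ∑ i, subsetPr p M (P i) := by
    have : ∑ i, subsetPr p M (P i)
        = subsetExp p M (fun S => ∑ i, if P i S then (1 : ℝ) else 0) := by
      simp only [subsetPr, subsetExp, Finset.mul_sum]
      rw [Finset.sum_comm]
    rw [this]
    refine subsetPr_le_subsetExp h₀ h₁
      (fun S _ => Finset.sum_nonneg fun i _ => by split_ifs <;> norm_num) ?_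
    rintro S - ⟨i, hi⟩
    have := Finset.single_le_sum (f := fun i => if P i S then (1 : ℝ) else 0)
      (fun j _ => by split_ifs <;> norm_num) (Finset.mem_univ i)
    simpa [hi] using this
  calc _ ≤ _ := key
    _ ≤ ∑ _i : ι, b := Finset.sum_le_sum fun i _ => h i
    _ = _ := by simp

lemma subsetPr_not (p : ℝ) (M : Finset α) (P : Finset α → Prop) :
    subsetPr p M P + subsetPr p M (fun S => ¬ P S) = 1 := by
  rw [subsetPr, subsetPr, ← subsetExp_add]
  refine Eq.trans ?_ (subsetExp_one p M)
  congr 1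
  ext S
  by_cases hP : P S <;> simp only [hP, not_true, not_false_eq_true, if_true, if_false] <;> norm_num

lemma subsetWeight_eq_mul (p : ℝ) (M S : Finset α) (A : α → Prop) [DecidablePred A] :
    subsetWeight p M S = subsetWeight p (M.filter A) (S.filter A) *
      subsetWeight p (M.filter fun e => ¬ A e) (S.filter fun e => ¬ A e) := by
  have h₁ : ∀ (B : α → Prop) [DecidablePred B], M.filter B \ S.filter B = (M \ S).filter B := by
    intro B _; ext e; simp only [Finset.mem_sdiff, Finset.mem_filter]; tauto
  rw [subsetWeight, subsetWeight, subsetWeight, h₁, h₁,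
    ← Finset.card_filter_add_card_filter_not (s := S) A,
    ← Finset.card_filter_add_card_filter_not (s := M \ S) A, pow_add, pow_add]
  ring

/-- Fubini: a `p`-random subset of `M` splits into independent parts inside and outside `A`. -/
lemma subsetExp_filter (p : ℝ) (M : Finset α) (A : α → Prop) [DecidablePred A] (f : Finset α → Finset α → ℝ) :
    subsetExp p M (fun S => f (S.filter A) (S.filter fun e => ¬ A e)) =
      subsetExp p (M.filter A) fun S₁ => subsetExp p (M.filter fun e => ¬ A e) (f S₁) := by
  simp only [subsetExp, Finset.mul_sum, ← mul_assoc]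
  rw [← Finset.sum_product']
  refine Finset.sum_nbij' (fun S => (S.filter A, S.filter fun e => ¬ A e))
    (fun q => q.1 ∪ q.2) ?_ ?_ ?_ ?_ ?_
  · intro S hS
    simp only [Finset.mem_product, Finset.mem_powerset] at hS ⊢
    exact ⟨Finset.filter_subset_filter _ hS, Finset.filter_subset_filter _ hS⟩
  · rintro ⟨S, T⟩ h
    simp only [Finset.mem_product, Finset.mem_powerset] at h ⊢
    exact Finset.union_subset (h.1.trans (Finset.filter_subset _ _))
      (h.2.trans (Finset.filter_subset _ _))
  · intro S _
    exact Finset.filter_union_filter_not_eq _ _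
  · rintro ⟨S, T⟩ h
    simp only [Finset.mem_product, Finset.mem_powerset] at h
    have h1 : ∀ e ∈ S, A e := fun e he => (Finset.mem_filter.1 (h.1 he)).2
    have h2 : ∀ e ∈ T, ¬ A e := fun e he => (Finset.mem_filter.1 (h.2 he)).2
    ext e <;> simp only [Finset.mem_filter, Finset.mem_union] <;>
      have := h1 e <;> have := h2 e <;> tauto
  · intro S _
    simp only []
    rw [← subsetWeight_eq_mul]

lemma subsetPr_filter_le (h₀ : 0 ≤ p) (h₁ : p ≤ 1) {M : Finset α} (A : α → Prop) [DecidablePred A]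
    (Q : Finset α → Finset α → Prop) {b : ℝ}
    (h : ∀ S₁ ⊆ M.filter A, subsetPr p (M.filter fun e => ¬ A e) (Q S₁) ≤ b) :
    subsetPr p M (fun S => Q (S.filter A) (S.filter fun e => ¬ A e)) ≤ b := by
  have := subsetExp_filter p M A (fun S T => if Q S T then (1 : ℝ) else 0)
  rw [subsetPr, this]
  refine (subsetExp_mono h₀ h₁ h).trans ?_
  have := subsetExp_mul_const p (M.filter A) (fun _ => 1) b
  rw [subsetExp_one] at this
  simpa using this.le

lemma subsetExp_prod_le (h₀ : 0 ≤ p) (h₁ : p ≤ 1) (M : Finset α) {x : α → ℝ}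
    (hx : ∀ e, 0 ≤ x e) :
    subsetExp p M (fun S => ∏ e ∈ S, x e) ≤ Real.exp (p * ∑ e ∈ M, (x e - 1)) := by
  rw [subsetExp_prod, Finset.mul_sum, Real.exp_sum]
  refine Finset.prod_le_prod (fun e _ => ?_) fun e _ => ?_
  · have := mul_nonneg h₀ (hx e); linarith
  · have := Real.add_one_le_exp (p * (x e - 1)); linarith

lemma exp_le_one_add_add_sq {x : ℝ} (hx : |x| ≤ 1) : Real.exp x ≤ 1 + x + x ^ 2 := by
  have := (abs_le.1 (Real.abs_exp_sub_one_sub_id_le hx)).2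
  linarith

/-- Exponential moment bound for a linear statistic of a `p`-random subset. -/
lemma subsetExp_exp_le (h₀ : 0 ≤ p) (h₁ : p ≤ 1) (M : Finset α) {w : α → ℝ} {L V s : ℝ}
    (hw : ∀ e, 0 ≤ w e) (hL : ∀ e, w e ≤ L) (hV : p * ∑ e ∈ M, w e ≤ V) (hs : |s| * L ≤ 1)
    (hL0 : 0 ≤ L) :
    subsetExp p M (fun S => Real.exp (s * ∑ e ∈ S, w e)) ≤
      Real.exp (s * (p * ∑ e ∈ M, w e) + s ^ 2 * L * V) := by
  have h := subsetExp_prod_le h₀ h₁ M (x := fun e => Real.exp (s * w e))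
    fun e => (Real.exp_pos _).le
  simp only [← Real.exp_sum, ← Finset.mul_sum] at h
  refine h.trans (Real.exp_le_exp.2 ?_)
  have h2 : ∑ e ∈ M, (Real.exp (s * w e) - 1) ≤ ∑ e ∈ M, (s * w e + s ^ 2 * L * w e) := by
    refine Finset.sum_le_sum fun e _ => ?_
    have h3 : |s * w e| ≤ 1 := by
      rw [abs_mul, abs_of_nonneg (hw e)]
      exact (mul_le_mul_of_nonneg_left (hL e) (abs_nonneg s)).trans hs
    have h4 := exp_le_one_add_add_sq h3
    have h5 : (s * w e) ^ 2 ≤ s ^ 2 * L * w e := by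
      have := mul_le_mul_of_nonneg_left
        (mul_le_mul_of_nonneg_right (hL e) (hw e)) (sq_nonneg s)
      nlinarith
    linarith
  rw [Finset.sum_add_distrib, ← Finset.mul_sum, ← Finset.mul_sum] at h2
  have h6 := mul_le_mul_of_nonneg_left h2 h₀
  have h7 := mul_le_mul_of_nonneg_left hV (mul_nonneg (sq_nonneg s) hL0)
  nlinarith

/-- Chernoff bound for a linear statistic of a `p`-random subset. -/
lemma subsetPr_deviation_le (h₀ : 0 ≤ p) (h₁ : p ≤ 1) (M : Finset α) {w : α → ℝ} {L V t : ℝ}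
    (hw : ∀ e, 0 ≤ w e) (hL : ∀ e, w e ≤ L) (hV : p * ∑ e ∈ M, w e ≤ V) (hL0 : 0 < L)
    (hV0 : 0 < V) (ht0 : 0 ≤ t) (ht : t ≤ 2 * V) :
    subsetPr p M (fun S => t < |∑ e ∈ S, w e - p * ∑ e ∈ M, w e|) ≤
      2 * Real.exp (-(t ^ 2 / (4 * L * V))) := by
  set μ := p * ∑ e ∈ M, w e with hμ
  have tail : ∀ s : ℝ, |s| = t / (2 * L * V) →
      subsetPr p M (fun S => t * |s| ≤ s * (∑ e ∈ S, w e - μ)) ≤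
        Real.exp (-(t ^ 2 / (4 * L * V))) := by
    intro s hs
    have hsL : |s| * L ≤ 1 := by
      rw [hs, div_mul_eq_mul_div, div_le_one (by positivity)]
      nlinarith
    have h := subsetExp_exp_le h₀ h₁ M hw hL hV hsL hL0.le
    calc _ ≤ subsetExp p M
            (fun S => Real.exp (s * ∑ e ∈ S, w e) * Real.exp (-(s * μ + t * |s|))) := by
          refine subsetPr_le_subsetExp h₀ h₁ (fun S _ => by positivity) fun S _ hS => ?_
          rw [← Real.exp_add]
          exact Real.one_le_exp (by linarith)
      _ ≤ Real.exp (s * μ + s ^ 2 * L * V) * Real.exp (-(s * μ + t * |s|)) := by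
          rw [subsetExp_mul_const]
          exact mul_le_mul_of_nonneg_right h (Real.exp_pos _).le
      _ = _ := by
          rw [← Real.exp_add, ← sq_abs s, hs]
          congr 1
          field_simp
          ring
  have hq : 0 ≤ t / (2 * L * V) := by positivity
  have h1 := tail (t / (2 * L * V)) (abs_of_nonneg hq)
  have h2 := tail (-(t / (2 * L * V))) (by rw [abs_neg, abs_of_nonneg hq])
  rw [abs_neg] at h2
  rw [abs_of_nonneg hq] at h1 h2
  refine (subsetPr_mono h₀ h₁ fun S _ hS => ?_).trans
    ((subsetPr_or_le h₀ h₁ M _ _).trans ((add_le_add h1 h2).trans (by linarith)))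
  rcases lt_abs.1 hS with h | h
  · left; nlinarith
  · right; nlinarith

end Binomial

section Edges

/-- The set of edges of `G`, as a finset. -/
def edges (G : SimpleGraph (Fin n)) : Finset (Sym2 (Fin n)) :=
  Finset.univ.filter (· ∈ G.edgeSet)

lemma mem_edges {G : SimpleGraph (Fin n)} {e : Sym2 (Fin n)} : e ∈ edges G ↔ e ∈ G.edgeSet := by
  simp [edges]

lemma card_edges (G : SimpleGraph (Fin n)) : (edges G).card = edgeCount G := by
  rw [edgeCount, ← Set.ncard_coe_finset]
  congr 1
  ext e
  simp [mem_edges]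

lemma card_edges_top : (edges (⊤ : SimpleGraph (Fin n))).card = n.choose 2 := by
  have := SimpleGraph.card_edgeFinset_top_eq_card_choose_two (V := Fin n)
  rw [Fintype.card_fin] at this
  rw [← this]
  congr 1
  ext e
  simp [mem_edges]

lemma fromEdgeSet_edges (G : SimpleGraph (Fin n)) :
    SimpleGraph.fromEdgeSet (edges G : Set (Sym2 (Fin n))) = G := by
  have : (edges G : Set (Sym2 (Fin n))) = G.edgeSet := by ext e; simp [mem_edges]
  rw [this, SimpleGraph.fromEdgeSet_edgeSet]

lemma edges_fromEdgeSet {K : SimpleGraph (Fin n)} {S : Finset (Sym2 (Fin n))}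
    (hS : S ⊆ edges Kᶜ) : edges (SimpleGraph.fromEdgeSet (S : Set (Sym2 (Fin n)))) = S := by
  ext e
  rw [mem_edges, SimpleGraph.edgeSet_fromEdgeSet]
  simp only [Set.mem_sdiff, Finset.mem_coe, and_iff_left_iff_imp]
  intro he
  simpa using Kᶜ.not_isDiag_of_mem_edgeSet (mem_edges.1 (hS he))

lemma sup_fromEdgeSet_sdiff {K : SimpleGraph (Fin n)} {S : Finset (Sym2 (Fin n))}
    (hS : S ⊆ edges Kᶜ) :
    (K ⊔ SimpleGraph.fromEdgeSet (S : Set (Sym2 (Fin n)))) \ K =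
      SimpleGraph.fromEdgeSet (S : Set (Sym2 (Fin n))) := by
  ext a b
  have h : s(a, b) ∈ S → ¬ K.Adj a b := fun h => by
    have := mem_edges.1 (hS h)
    rw [SimpleGraph.mem_edgeSet, SimpleGraph.compl_adj] at this
    exact this.2
  simp only [SimpleGraph.sdiff_adj, SimpleGraph.sup_adj, SimpleGraph.fromEdgeSet_adj,
    Finset.mem_coe]
  tauto

lemma edges_sdiff_subset (F K : SimpleGraph (Fin n)) : edges (F \ K) ⊆ edges Kᶜ := by
  intro e he
  rw [mem_edges] at he ⊢
  induction e with
  | h a b =>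
    rw [SimpleGraph.mem_edgeSet, SimpleGraph.sdiff_adj] at he
    rw [SimpleGraph.mem_edgeSet, SimpleGraph.compl_adj]
    exact ⟨he.1.ne, he.2⟩

lemma edgeCount_sub_of_le {K F : SimpleGraph (Fin n)} (h : K ≤ F) :
    edgeCount F - edgeCount K = (edges (F \ K)).card := by
  have h1 : edges (F \ K) = edges F \ edges K := by ext e; simp [mem_edges]
  have h2 : edges K ⊆ edges F := fun e he =>
    mem_edges.2 (SimpleGraph.edgeSet_mono h (mem_edges.1 he))
  rw [h1, Finset.card_sdiff_of_subset h2, card_edges, card_edges]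

lemma choose_two_sub_edgeCount {K F : SimpleGraph (Fin n)} (h : K ≤ F) :
    n.choose 2 - edgeCount F = (edges Kᶜ \ edges (F \ K)).card := by
  have h1 : edges Kᶜ \ edges (F \ K) = edges ⊤ \ edges F := by
    ext e
    induction e with
    | h a b =>
      have := @h a b
      simp only [Finset.mem_sdiff, mem_edges, SimpleGraph.mem_edgeSet, SimpleGraph.compl_adj,
        SimpleGraph.sdiff_adj, SimpleGraph.top_adj]
      tauto
  have h2 : edges F ⊆ edges ⊤ := fun e he =>
    mem_edges.2 (SimpleGraph.edgeSet_mono le_top (mem_edges.1 he))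
  rw [h1, Finset.card_sdiff_of_subset h2, card_edges_top, card_edges]

lemma prEvent_eq_subsetPr {ρ : PMF (SimpleGraph (Fin n))} {K : SimpleGraph (Fin n)} {p : ℝ}
    (hρ : IsAddGnp ρ K p) (h₀ : 0 ≤ p) (h₁ : p ≤ 1) (P : SimpleGraph (Fin n) → Prop) :
    prEvent ρ P = ENNReal.ofReal (subsetPr p (edges Kᶜ)
      fun S => P (K ⊔ SimpleGraph.fromEdgeSet (S : Set (Sym2 (Fin n))))) := by
  rw [prEvent, tsum_fintype, subsetPr, subsetExp, ENNReal.ofReal_sum_of_nonneg]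
  · have : ∑ F, (if P F then ρ F else 0) =
        ∑ F ∈ Finset.univ.filter (K ≤ ·), if P F then ρ F else 0 := by
      rw [Finset.sum_filter]
      refine Finset.sum_congr rfl fun F _ => ?_
      by_cases hF : K ≤ F <;> simp [hρ F, hF]
    rw [this]
    have hsup : ∀ F, K ≤ F →
        K ⊔ SimpleGraph.fromEdgeSet (edges (F \ K) : Set (Sym2 (Fin n))) = F := by
      intro F hF
      rw [fromEdgeSet_edges, sup_sdiff_cancel_right hF]
    refine Finset.sum_nbij' (fun F => edges (F \ K))
      (fun S => K ⊔ SimpleGraph.fromEdgeSet (S : Set (Sym2 (Fin n)))) ?_ ?_ ?_ ?_ ?_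
    · intro F _
      exact Finset.mem_powerset.2 (edges_sdiff_subset F K)
    · intro S _
      simp
    · intro F hF
      exact hsup F (Finset.mem_filter.1 hF).2
    · intro S hS
      rw [Finset.mem_powerset] at hS
      simp only [sup_fromEdgeSet_sdiff hS, edges_fromEdgeSet hS]
    · intro F hF
      have hF := (Finset.mem_filter.1 hF).2
      rw [hsup F hF, hρ F, if_pos hF, edgeCount_sub_of_le hF, choose_two_sub_edgeCount hF]
      split_ifs <;> simp [subsetWeight]
  · intro S _
    exact mul_nonneg (subsetWeight_nonneg h₀ h₁ _ _) (by split_ifs <;> norm_num)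

/-- If the complement of `P` is unlikely, then `P` is likely. -/
lemma le_prEvent_of_subsetPr_le {ρ : PMF (SimpleGraph (Fin n))} {K : SimpleGraph (Fin n)} {p : ℝ}
    (hρ : IsAddGnp ρ K p) (h₀ : 0 ≤ p) (h₁ : p ≤ 1) (P : SimpleGraph (Fin n) → Prop)
    {Q : Finset (Sym2 (Fin n)) → Prop} {b : ℝ} (hb : subsetPr p (edges Kᶜ) Q ≤ b)
    (h : ∀ S ⊆ edges Kᶜ, ¬ Q S → P (K ⊔ SimpleGraph.fromEdgeSet (S : Set (Sym2 (Fin n))))) :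
    ENNReal.ofReal (1 - b) ≤ prEvent ρ P := by
  rw [prEvent_eq_subsetPr hρ h₀ h₁]
  refine ENNReal.ofReal_le_ofReal ?_
  have h2 := subsetPr_not p (edges Kᶜ) Q
  have h3 := subsetPr_mono h₀ h₁ h
  linarith

/-- The number of members of `S` incident to `v`. -/
def incDeg (S : Finset (Sym2 (Fin n))) (v : Fin n) : ℕ := (S.filter (v ∈ ·)).card

lemma deg_eq_card (G : SimpleGraph (Fin n)) (v : Fin n) :
    deg G v = (Finset.univ.filter (G.Adj v)).card := by
  rw [deg, Nat.card_eq_fintype_card, Fintype.card_subtype]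
  rfl

lemma incDeg_eq_card (S : Finset (Sym2 (Fin n))) (v : Fin n) :
    incDeg S v = (Finset.univ.filter fun u => s(v, u) ∈ S).card := by
  rw [incDeg]
  symm
  refine Finset.card_nbij (fun u => s(v, u)) ?_ ?_ ?_
  · intro u hu
    simpa using hu
  · intro a _ b _ hab
    exact Sym2.congr_right.1 hab
  · intro e he
    simp only [Finset.coe_filter, Set.mem_ofPred_eq] at he
    obtain ⟨u, rfl⟩ := Sym2.mem_iff_exists.1 he.2
    exact ⟨u, by simpa using he.1, rfl⟩

lemma incDeg_edges (G : SimpleGraph (Fin n)) (v : Fin n) : incDeg (edges G) v = deg G v := by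
  simp only [incDeg_eq_card, deg_eq_card, mem_edges, SimpleGraph.mem_edgeSet]

lemma incDeg_edges_compl {K : SimpleGraph (Fin n)} {d : ℕ} (hK : IsRegularGraph K d)
    (v : Fin n) : (incDeg (edges Kᶜ) v : ℝ) = n - 1 - d := by
  have h : deg K v + deg Kᶜ v + 1 = n := by
    rw [deg_eq_card, deg_eq_card, ← Finset.card_union_of_disjoint,
      ← Finset.card_insert_of_notMem (a := v)]
    · convert Finset.card_fin n
      ext u
      by_cases huv : v = u <;> simp [huv, em, eq_comm]
    · simp
    · rw [Finset.disjoint_left]; intro u; simp; tauto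
  rw [hK v] at h
  rw [incDeg_edges]
  have : (n : ℝ) = d + deg Kᶜ v + 1 := by exact_mod_cast h.symm
  linarith

lemma deg_sup_fromEdgeSet_sdiff {K : SimpleGraph (Fin n)} {S : Finset (Sym2 (Fin n))}
    (hS : S ⊆ edges Kᶜ) (v : Fin n) :
    deg ((K ⊔ SimpleGraph.fromEdgeSet (S : Set (Sym2 (Fin n)))) \ K) v = incDeg S v := by
  rw [← incDeg_edges, sup_fromEdgeSet_sdiff hS, edges_fromEdgeSet hS]

/-- The number of paths `v u u'` whose first edge is in `S` and second edge is in `K`. -/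
def codeg (K : SimpleGraph (Fin n)) (S : Finset (Sym2 (Fin n))) (v u' : Fin n) : ℕ :=
  (Finset.univ.filter fun u => K.Adj u' u ∧ s(v, u) ∈ S).card

lemma doubleDegSum_eq {K : SimpleGraph (Fin n)} {S : Finset (Sym2 (Fin n))}
    (hS : S ⊆ edges Kᶜ) (v : Fin n) :
    doubleDegSum (K ⊔ SimpleGraph.fromEdgeSet (S : Set (Sym2 (Fin n)))) K v =
      ∑ u', (codeg K S v u' : ℝ) * incDeg S u' := by
  have hadj : ∀ u, ((K ⊔ SimpleGraph.fromEdgeSet (S : Set (Sym2 (Fin n)))) \ K).Adj v u ↔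
      s(v, u) ∈ S := by
    intro u
    rw [sup_fromEdgeSet_sdiff hS, ← SimpleGraph.mem_edgeSet, ← mem_edges, edges_fromEdgeSet hS]
  simp only [doubleDegSum, deg_sup_fromEdgeSet_sdiff hS, hadj, codeg, Finset.card_filter,
    Nat.cast_sum, Finset.sum_mul]
  rw [Finset.sum_comm]
  refine Finset.sum_congr rfl fun u _ => ?_
  by_cases hu : s(v, u) ∈ S
  · simp [hu, K.adj_comm u]
  · simp [hu]

end Edges

section Concentration

variable {K : SimpleGraph (Fin n)} {d : ℕ} {p : ℝ}

lemma subsetPr_incDeg_deviation_le (hK : IsRegularGraph K d) (h₀ : 0 ≤ p) (h₁ : p ≤ 1)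
    (v : Fin n) {δ t : ℝ} (hδ : p * (n - 1 - d) = δ) (hδ0 : 0 < δ) (ht0 : 0 ≤ t)
    (ht : t ≤ 2 * δ) :
    subsetPr p (edges Kᶜ) (fun S => t < |(incDeg S v : ℝ) - δ|) ≤
      2 * Real.exp (-(t ^ 2 / (4 * δ))) := by
  have hsum : ∀ S : Finset (Sym2 (Fin n)),
      ∑ e ∈ S, (if v ∈ e then (1 : ℝ) else 0) = incDeg S v := by
    intro S
    rw [Finset.sum_boole, incDeg]
  have hmean : p * ∑ e ∈ edges Kᶜ, (if v ∈ e then (1 : ℝ) else 0) = δ := by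
    rw [hsum, incDeg_edges_compl hK, hδ]
  have h := subsetPr_deviation_le h₀ h₁ (edges Kᶜ) (w := fun e => if v ∈ e then (1 : ℝ) else 0)
    (L := 1) (V := δ) (t := t) (fun e => by split_ifs <;> norm_num)
    (fun e => by split_ifs <;> norm_num) hmean.le one_pos hδ0 ht0 ht
  rw [hmean] at h
  simpa only [hsum, mul_one] using h

lemma codeg_eq_card_filter (K : SimpleGraph (Fin n)) (S : Finset (Sym2 (Fin n)))
    (v u' : Fin n) :
    codeg K S v u' =
      (S.filter (· ∈ (Finset.univ.filter (K.Adj u')).image fun u => s(v, u))).card := by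
  rw [codeg]
  refine Finset.card_nbij (fun u => s(v, u)) ?_ ?_ ?_
  · intro u hu
    simp only [Finset.coe_filter, Finset.mem_univ, true_and, Set.mem_ofPred_eq,
      Finset.mem_image, Finset.mem_filter] at hu ⊢
    exact ⟨hu.2, u, hu.1, rfl⟩
  · intro a _ b _ hab
    exact Sym2.congr_right.1 hab
  · intro e he
    simp only [Finset.coe_filter, Finset.mem_univ, true_and, Set.mem_ofPred_eq,
      Finset.mem_image, Finset.mem_filter] at he
    obtain ⟨he, u, hu, rfl⟩ := he
    exact ⟨u, by simpa using ⟨hu, he⟩, rfl⟩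

lemma subsetPr_lt_codeg_le (hK : IsRegularGraph K d) (h₀ : 0 ≤ p) (h₁ : p ≤ 1)
    (v u' : Fin n) {x : ℝ} (hx : 1 ≤ x) (L : ℕ) :
    subsetPr p (edges Kᶜ) (fun S => L < codeg K S v u') ≤ Real.exp (p * (d * x)) / x ^ L := by
  set T := (Finset.univ.filter (K.Adj u')).image fun u => s(v, u) with hT
  have hTd : (T.card : ℝ) ≤ d := by
    have h := hK u'
    rw [deg_eq_card] at h
    exact_mod_cast Finset.card_image_le.trans h.le
  have hx0 : 0 < x := one_pos.trans_le hx
  have hprod : ∀ S : Finset (Sym2 (Fin n)),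
      ∏ e ∈ S, (if e ∈ T then x else 1) = x ^ codeg K S v u' := by
    intro S
    rw [Finset.prod_ite, Finset.prod_const, Finset.prod_const_one, mul_one,
      codeg_eq_card_filter]
  have hexp := subsetExp_prod_le h₀ h₁ (edges Kᶜ) (x := fun e => if e ∈ T then x else 1)
    (fun e => by split_ifs <;> positivity)
  have hsum : ∑ e ∈ edges Kᶜ, ((if e ∈ T then x else 1) - 1) ≤ d * x := by
    calc _ = ∑ e ∈ edges Kᶜ, (if e ∈ T then x - 1 else 0) :=
          Finset.sum_congr rfl fun e _ => by split_ifs <;> ring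
      _ = ((edges Kᶜ).filter (· ∈ T)).card * (x - 1) := by
          rw [← Finset.sum_filter, Finset.sum_const, nsmul_eq_mul]
      _ ≤ T.card * (x - 1) := by
          refine mul_le_mul_of_nonneg_right ?_ (by linarith)
          exact_mod_cast Finset.card_le_card fun e he => (Finset.mem_filter.1 he).2
      _ ≤ d * x := by nlinarith [(Nat.cast_nonneg d : (0 : ℝ) ≤ d)]
  simp only [hprod] at hexp
  calc _ ≤ subsetExp p (edges Kᶜ) (fun S => x ^ codeg K S v u' * (x ^ L)⁻¹) := by
        refine subsetPr_le_subsetExp h₀ h₁ (fun S _ => by positivity) fun S _ hS => ?_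
        rw [← div_eq_mul_inv, one_le_div (by positivity)]
        exact pow_le_pow_right₀ hx hS.le
    _ ≤ _ := by
        rw [subsetExp_mul_const, div_eq_mul_inv]
        refine mul_le_mul_of_nonneg_right (hexp.trans (Real.exp_le_exp.2 ?_)) (by positivity)
        exact mul_le_mul_of_nonneg_left hsum h₀

/-- The sum of the weights of the endpoints of `e`. -/
def endWeight (w : Fin n → ℝ) (e : Sym2 (Fin n)) : ℝ := ∑ u, if u ∈ e then w u else 0

lemma endWeight_nonneg {w : Fin n → ℝ} (hw : ∀ u, 0 ≤ w u) (e : Sym2 (Fin n)) :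
    0 ≤ endWeight w e :=
  Finset.sum_nonneg fun u _ => by split_ifs <;> simp [hw u]

lemma endWeight_le {w : Fin n → ℝ} {L : ℝ} (hL0 : 0 ≤ L) (hL : ∀ u, w u ≤ L)
    (e : Sym2 (Fin n)) : endWeight w e ≤ 2 * L := by
  induction e with
  | h a b =>
    rw [endWeight, ← Finset.sum_filter]
    calc _ ≤ ∑ _u ∈ Finset.univ.filter (· ∈ s(a, b)), L := Finset.sum_le_sum fun u _ => hL u
      _ = (Finset.univ.filter (· ∈ s(a, b))).card * L := by simp
      _ ≤ 2 * L := by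
        refine mul_le_mul_of_nonneg_right ?_ hL0
        have : (Finset.univ.filter (· ∈ s(a, b))) ⊆ {a, b} := by
          intro u; simp
        exact_mod_cast (Finset.card_le_card this).trans Finset.card_le_two

lemma sum_endWeight (w : Fin n → ℝ) (S : Finset (Sym2 (Fin n))) :
    ∑ e ∈ S, endWeight w e = ∑ u, w u * incDeg S u := by
  simp only [endWeight]
  rw [Finset.sum_comm]
  refine Finset.sum_congr rfl fun u _ => ?_
  rw [← Finset.sum_filter, Finset.sum_const, nsmul_eq_mul, mul_comm, incDeg]

lemma incDeg_filter_add (S : Finset (Sym2 (Fin n))) (v u : Fin n) :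
    incDeg (S.filter (v ∈ ·)) u + incDeg (S.filter fun e => ¬ v ∈ e) u = incDeg S u := by
  rw [incDeg, incDeg, incDeg, Finset.filter_comm, Finset.filter_comm (v ∉ ·),
    Finset.card_filter_add_card_filter_not]

lemma incDeg_filter_le_one (S : Finset (Sym2 (Fin n))) {v u : Fin n} (h : u ≠ v) :
    incDeg (S.filter (v ∈ ·)) u ≤ 1 := by
  rw [incDeg]
  refine (Finset.card_le_card (t := {s(v, u)}) fun e he => ?_).trans_eq (Finset.card_singleton _)
  simp only [Finset.mem_filter] at he
  rw [Finset.mem_singleton]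
  exact ((Sym2.mem_and_mem_iff h.symm).1 ⟨he.1.2, he.2⟩)

lemma codeg_filter (S : Finset (Sym2 (Fin n))) (v u' : Fin n) :
    codeg K (S.filter (v ∈ ·)) v u' = codeg K S v u' := by
  simp [codeg]

lemma codeg_self {S : Finset (Sym2 (Fin n))} (hS : S ⊆ edges Kᶜ) (v : Fin n) :
    codeg K S v v = 0 := by
  rw [codeg, Finset.card_eq_zero, Finset.filter_eq_empty_iff]
  rintro u - ⟨h1, h2⟩
  have := mem_edges.1 (hS h2)
  rw [SimpleGraph.mem_edgeSet, SimpleGraph.compl_adj] at this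
  exact this.2 h1

lemma sum_codeg (hK : IsRegularGraph K d) (S : Finset (Sym2 (Fin n))) (v : Fin n) :
    ∑ u', (codeg K S v u' : ℝ) = d * incDeg S v := by
  have h : ∑ u', codeg K S v u' = d * incDeg S v := by
    simp only [codeg, Finset.card_filter]
    rw [Finset.sum_comm, incDeg_eq_card, Finset.card_filter, Finset.mul_sum]
    refine Finset.sum_congr rfl fun u _ => ?_
    have h := hK u
    rw [deg_eq_card, Finset.card_filter] at h
    by_cases hu : s(v, u) ∈ S
    · simpa [hu, K.adj_comm u] using h
    · simp [hu]
  exact_mod_cast h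

/-- The sum of endpoint weights over all non-edges of `K` avoiding `v` is close to its
idealised value. -/
lemma sum_endWeight_codeg_bounds (hK : IsRegularGraph K d) {S : Finset (Sym2 (Fin n))}
    (hS : S ⊆ edges Kᶜ) (v : Fin n) :
    (d * incDeg S v : ℝ) * (n - 1 - d) - d * incDeg S v ≤
        ∑ e ∈ (edges Kᶜ).filter (fun e => ¬ v ∈ e), endWeight (fun u => codeg K S v u) e ∧
      ∑ e ∈ (edges Kᶜ).filter (fun e => ¬ v ∈ e), endWeight (fun u => codeg K S v u) e ≤
        (d * incDeg S v : ℝ) * (n - 1 - d) := by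
  have hdeg : ∀ u, (incDeg ((edges Kᶜ).filter (v ∈ ·)) u : ℝ) +
      incDeg ((edges Kᶜ).filter fun e => ¬ v ∈ e) u = n - 1 - d := by
    intro u
    rw [← incDeg_edges_compl hK u, ← incDeg_filter_add (edges Kᶜ) v u]
    push_cast
    ring
  rw [sum_endWeight, ← sum_codeg hK S v, Finset.sum_mul, ← Finset.sum_sub_distrib]
  constructor <;> refine Finset.sum_le_sum fun u _ => ?_
  · have h := hdeg u
    rcases eq_or_ne u v with rfl | huv
    · simp [codeg_self hS]
    · have h1 : (incDeg ((edges Kᶜ).filter (v ∈ ·)) u : ℝ) ≤ 1 := by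
        exact_mod_cast incDeg_filter_le_one _ huv
      have h2 : (0 : ℝ) ≤ codeg K S v u := Nat.cast_nonneg _
      nlinarith
  · have h := hdeg u
    have h1 : (0 : ℝ) ≤ incDeg ((edges Kᶜ).filter (v ∈ ·)) u := Nat.cast_nonneg _
    exact mul_le_mul_of_nonneg_left (by linarith) (Nat.cast_nonneg _)

lemma subsetPr_false (p : ℝ) (M : Finset (Sym2 (Fin n))) {P : Finset (Sym2 (Fin n)) → Prop}
    (h : ∀ S, ¬ P S) : subsetPr p M P = 0 := by
  simp [subsetPr, subsetExp, h]

/-- Conditionally on the edges at `v`, the contribution of the remaining edges is concentrated. -/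
lemma subsetPr_sum_endWeight_deviation_le (hK : IsRegularGraph K d) (h₀ : 0 ≤ p) (h₁ : p ≤ 1)
    (v : Fin n) {δ : ℝ} (hδ : p * (n - 1 - d) = δ) (hδ1 : 1 ≤ δ) (hd : 0 < d) {L : ℕ}
    (hL : 0 < L) :
    subsetPr p (edges Kᶜ) (fun S => (δ / 2 ≤ incDeg S v ∧ ∀ u, codeg K S v u ≤ L) ∧
      (d * incDeg S v : ℝ) < |∑ e ∈ S.filter (fun e => ¬ v ∈ e),
        endWeight (fun u => codeg K S v u) e -
        p * ∑ e ∈ (edges Kᶜ).filter (fun e => ¬ v ∈ e),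
          endWeight (fun u => codeg K S v u) e|) ≤
      2 * Real.exp (-(d / (16 * L))) := by
  have key := subsetPr_filter_le h₀ h₁ (M := edges Kᶜ) (v ∈ ·)
    (fun S₁ S₂ => (δ / 2 ≤ incDeg S₁ v ∧ ∀ u, codeg K S₁ v u ≤ L) ∧
      (d * incDeg S₁ v : ℝ) < |∑ e ∈ S₂, endWeight (fun u => codeg K S₁ v u) e -
        p * ∑ e ∈ (edges Kᶜ).filter (fun e => ¬ v ∈ e),
          endWeight (fun u => codeg K S₁ v u) e|) (b := 2 * Real.exp (-(d / (16 * L)))) ?_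
  · have hinc : ∀ S : Finset (Sym2 (Fin n)), incDeg (S.filter (v ∈ ·)) v = incDeg S v := by
      intro S; simp [incDeg, Finset.filter_filter]
    simpa only [hinc, codeg_filter] using key
  intro S₁ hS₁
  have hS₁ : S₁ ⊆ edges Kᶜ := hS₁.trans (Finset.filter_subset _ _)
  by_cases hgood : δ / 2 ≤ (incDeg S₁ v : ℝ) ∧ ∀ u, codeg K S₁ v u ≤ L
  swap
  · rw [subsetPr_false]
    · positivity
    · intro S h
      exact hgood h.1
  have hL0 : (0 : ℝ) < L := by exact_mod_cast hL
  have hd0 : (0 : ℝ) < d := by exact_mod_cast hd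
  set T : ℝ := d * incDeg S₁ v with hT
  have hT2 : d * (δ / 2) ≤ T := mul_le_mul_of_nonneg_left hgood.1 hd0.le
  have hT0 : 0 < T := lt_of_lt_of_le (by positivity) hT2
  have h := subsetPr_deviation_le h₀ h₁ ((edges Kᶜ).filter fun e => ¬ v ∈ e)
    (w := endWeight fun u => codeg K S₁ v u) (L := 2 * L) (V := T * δ) (t := T)
    (endWeight_nonneg fun u => Nat.cast_nonneg _)
    (endWeight_le hL0.le fun u => by exact_mod_cast hgood.2 u)
    (by
      have := mul_le_mul_of_nonneg_left (sum_endWeight_codeg_bounds hK hS₁ v).2 h₀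
      rw [← hT] at this
      calc _ ≤ _ := this
        _ = T * (p * (n - 1 - d)) := by ring
        _ = _ := by rw [hδ])
    (by positivity) (by positivity) hT0.le (by nlinarith)
  refine (subsetPr_mono h₀ h₁ fun S _ hS => hS.2).trans (h.trans ?_)
  refine mul_le_mul_of_nonneg_left (Real.exp_le_exp.2 (neg_le_neg ?_)) two_pos.le
  rw [div_le_div_iff₀ (by positivity) (by positivity)]
  have : 0 ≤ 8 * (L : ℝ) * T := by positivity
  nlinarith

lemma doubleDegSum_deviation_le (hK : IsRegularGraph K d) (h₀ : 0 ≤ p) (h₁ : p ≤ 1)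
    (v : Fin n) {δ : ℝ} (hδ : p * (n - 1 - d) = δ) {L : ℕ} (hLd : 2 * L ≤ d)
    {S : Finset (Sym2 (Fin n))} (hS : S ⊆ edges Kᶜ) (hcodeg : ∀ u, codeg K S v u ≤ L)
    (hdev : |∑ e ∈ S.filter (fun e => ¬ v ∈ e), endWeight (fun u => codeg K S v u) e -
        p * ∑ e ∈ (edges Kᶜ).filter (fun e => ¬ v ∈ e),
          endWeight (fun u => codeg K S v u) e| ≤ d * incDeg S v) :
    |doubleDegSum (K ⊔ SimpleGraph.fromEdgeSet (S : Set (Sym2 (Fin n)))) K v -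
      incDeg S v * δ * d| ≤ 2 * (incDeg S v * d) := by
  obtain ⟨hlo, hhi⟩ := sum_endWeight_codeg_bounds hK hS v
  have hsplit : doubleDegSum (K ⊔ SimpleGraph.fromEdgeSet (S : Set (Sym2 (Fin n)))) K v =
      ∑ e ∈ S.filter (v ∈ ·), endWeight (fun u => codeg K S v u) e +
        ∑ e ∈ S.filter (fun e => ¬ v ∈ e), endWeight (fun u => codeg K S v u) e := by
    rw [doubleDegSum_eq hS, ← sum_endWeight (fun u => (codeg K S v u : ℝ)),
      Finset.sum_filter_add_sum_filter_not]
  have hS1 : 0 ≤ ∑ e ∈ S.filter (v ∈ ·), endWeight (fun u => codeg K S v u) e :=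
    Finset.sum_nonneg fun e _ => endWeight_nonneg (fun u => Nat.cast_nonneg _) e
  have hS2 : ∑ e ∈ S.filter (v ∈ ·), endWeight (fun u => codeg K S v u) e ≤
      d * incDeg S v := by
    calc _ ≤ ∑ _e ∈ S.filter (v ∈ ·), (2 * L : ℝ) := Finset.sum_le_sum fun e _ =>
          endWeight_le (Nat.cast_nonneg L) (fun u => by exact_mod_cast hcodeg u) e
      _ = 2 * L * incDeg S v := by simp [incDeg, mul_comm]
      _ ≤ _ := mul_le_mul_of_nonneg_right (by exact_mod_cast hLd) (Nat.cast_nonneg _)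
  have hlo' := mul_le_mul_of_nonneg_left hlo h₀
  have hhi' := mul_le_mul_of_nonneg_left hhi h₀
  have hT : (0 : ℝ) ≤ d * incDeg S v := by positivity
  have h5 : p * (d * incDeg S v : ℝ) ≤ d * incDeg S v := mul_le_of_le_one_left hT h₁
  have h6 : p * ((d * incDeg S v : ℝ) * (n - 1 - d)) = incDeg S v * δ * d := by
    rw [← hδ]; ring
  rw [mul_sub, h6] at hlo'
  rw [h6] at hhi'
  rw [hsplit]
  rw [abs_le] at hdev ⊢
  constructor <;> linarith [hdev.1, hdev.2]

lemma subsetPr_doubleDegSum_deviation_le (hK : IsRegularGraph K d) (h₀ : 0 ≤ p) (h₁ : p ≤ 1)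
    (v : Fin n) {δ : ℝ} (hδ : p * (n - 1 - d) = δ) (hδ1 : 1 ≤ δ) {L : ℕ} (hL : 0 < L)
    (hLd : 2 * L ≤ d) {x : ℝ} (hx : 1 ≤ x) :
    subsetPr p (edges Kᶜ) (fun S => 2 * (incDeg S v * d : ℝ) <
      |doubleDegSum (K ⊔ SimpleGraph.fromEdgeSet (S : Set (Sym2 (Fin n)))) K v -
        incDeg S v * δ * d|) ≤
      2 * Real.exp (-(δ / 16)) + (n * (Real.exp (p * (d * x)) / x ^ L) +
        2 * Real.exp (-(d / (16 * L)))) := by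
  have hA := subsetPr_incDeg_deviation_le hK h₀ h₁ v hδ (t := δ / 2) (by linarith)
    (by linarith) (by linarith)
  have hB := subsetPr_exists_le h₀ h₁ (edges Kᶜ) (fun (u : Fin n) S => L < codeg K S v u)
    fun u => subsetPr_lt_codeg_le hK h₀ h₁ v u hx L
  have hC := subsetPr_sum_endWeight_deviation_le hK h₀ h₁ v hδ hδ1 (by omega) hL
  rw [Fintype.card_fin] at hB
  have hexp : (δ / 2) ^ 2 / (4 * δ) = δ / 16 := by field_simp; norm_num
  rw [hexp] at hA
  refine (subsetPr_mono h₀ h₁ fun S hS hbad => ?_).trans ((subsetPr_or_le h₀ h₁ _ _ _).trans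
    (add_le_add hA ((subsetPr_or_le h₀ h₁ _ _ _).trans (add_le_add hB hC))))
  by_contra! hcon
  obtain ⟨h1, h2, h3⟩ := hcon
  refine hbad.not_ge (doubleDegSum_deviation_le hK h₀ h₁ v hδ hLd hS h2 (h3 ⟨?_, h2⟩))
  linarith [(abs_le.1 h1).1]

end Concentration

lemma exp_neg_le_one_div_pow {n : ℕ} (hn : 0 < n) {a : ℝ} (h : 16 * Real.log n ≤ a) :
    Real.exp (-a) ≤ 1 / (n : ℝ) ^ 16 := by
  have hn0 : (0 : ℝ) < n := by exact_mod_cast hn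
  calc Real.exp (-a) ≤ Real.exp (-(Real.log ((n : ℝ) ^ 16))) := by
        refine Real.exp_le_exp.2 (neg_le_neg ?_)
        rw [Real.log_pow]
        exact_mod_cast h
    _ = _ := by rw [Real.exp_neg, Real.exp_log (by positivity), one_div]

/-- In the sparse regime, the expected codegrees are polynomially small. -/
lemma edge_prob_mul_le_one {n d m : ℕ} {σ δ p : ℝ} (hn : 256 ≤ n) (hσ : σ ≤ 1 / 8)
    (hδ : δ = 2 * (m : ℝ) / n) (hpδ : p * (n - 1 - d) = δ) (hp : 0 ≤ p)
    (hd : (d : ℝ) ≤ (n : ℝ) ^ σ) (hm : (m : ℝ) ≤ (n : ℝ) ^ ((1 : ℝ) + σ)) :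
    p * (d * Real.sqrt n) ≤ 1 := by
  have hn1 : (256 : ℝ) ≤ n := by exact_mod_cast hn
  have hn0 : (0 : ℝ) < n := by linarith
  obtain ⟨z, hz⟩ : ∃ z : ℝ, z = (n : ℝ) ^ (1 / 8 : ℝ) := ⟨_, rfl⟩
  have hz0 : 0 ≤ z := hz ▸ Real.rpow_nonneg hn0.le _
  have hz8 : z ^ 8 = n := by
    rw [hz, ← Real.rpow_natCast, ← Real.rpow_mul hn0.le]
    norm_num
  have hz2 : 2 ≤ z := by
    refine le_of_pow_le_pow_left₀ (n := 8) (by norm_num) hz0 ?_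
    rw [hz8]
    norm_num
    exact hn
  have hsqrt : Real.sqrt n = z ^ 4 := by
    rw [← hz8, show z ^ 8 = (z ^ 4) ^ 2 by ring, Real.sqrt_sq (by positivity)]
  have hnσ : (n : ℝ) ^ σ ≤ z := by
    rw [hz]
    exact Real.rpow_le_rpow_of_exponent_le (by linarith) hσ
  have hdz : (d : ℝ) ≤ z := hd.trans hnσ
  have hδz : δ ≤ 2 * z := by
    rw [Real.rpow_add hn0, Real.rpow_one] at hm
    have := mul_le_mul_of_nonneg_left hnσ hn0.le
    rw [hδ, div_le_iff₀ hn0]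
    linarith
  have hz6 : 2 ^ 6 ≤ z ^ 6 := pow_le_pow_left₀ (by norm_num) hz2 6
  have hz7 : z ≤ z ^ 6 := le_self_pow₀ (by linarith) (by norm_num)
  have hden : 2 * z ^ 6 ≤ n - 1 - d := by
    have : 4 * z ^ 6 ≤ z ^ 8 := by
      nlinarith [mul_le_mul_of_nonneg_left (pow_le_pow_left₀ zero_le_two hz2 2) (pow_nonneg hz0 6)]
    rw [← hz8]
    linarith
  have h1 : p * (2 * z ^ 6) ≤ 2 * z := (mul_le_mul_of_nonneg_left hden hp).trans (hpδ ▸ hδz)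
  have h2 : p * z ^ 5 ≤ 1 := by
    have : 2 * z * (p * z ^ 5) ≤ 2 * z * 1 := by
      linarith [show p * (2 * z ^ 6) = 2 * z * (p * z ^ 5) by ring]
    exact le_of_mul_le_mul_left this (by linarith)
  calc p * (d * Real.sqrt n) ≤ p * (z * z ^ 4) := by
        rw [hsqrt]
        gcongr
    _ = p * z ^ 5 := by ring
    _ ≤ 1 := h2

/-- **Lemma 5.3.** There is `c* > 0` such that for every `ε ∈ (0,1]`, every `C' ≥ 1/c*` and
every `σ ∈ (0,c*]` there is `C > 0` such that for every `c > 0` and all sufficiently large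
`n`: with `C log n ≤ d ≤ n−1`, `ε d n/2 ≤ m ≤ binom(n,2) − dn/2`, `δ = 2m/n`,
`p = m(binom(n,2) − dn/2)⁻¹`, `K ∈ 𝒦_d(n)` and `F = K + E` as usual, (i) with probability
at least `1 − c n⁻¹⁴` all degrees of `F∖K` are `(1 ± C'√(log n/δ))δ`; and (ii) if moreover
`d ≤ n^σ` and `m ≤ n^{1+σ}`, then with probability at least `1 − c n⁻¹⁴` the double
neighbourhood degree sums are `(1 ± 2/δ)·d_{F∖K}(v)·δ·d`. -/
theorem degree_and_neighbourhood_sums :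
    ∃ cstar : ℝ, 0 < cstar ∧
      ∀ ε : ℝ, 0 < ε → ε ≤ 1 →
        ∀ C' : ℝ, 1 / cstar ≤ C' →
          ∀ σ : ℝ, 0 < σ → σ ≤ cstar →
            ∃ C : ℝ, 0 < C ∧
              ∀ c : ℝ, 0 < c →
                ∃ n₀ : ℕ, ∀ n : ℕ, n₀ ≤ n →
                  ∀ d m : ℕ, C * Real.log n ≤ (d : ℝ) → d ≤ n - 1 →
                    ε * d * n / 2 ≤ (m : ℝ) → (m : ℝ) ≤ (n.choose 2 : ℝ) - d * n / 2 →
                    ∀ δ p : ℝ, δ = 2 * (m : ℝ) / n →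
                      p = (m : ℝ) / ((n.choose 2 : ℝ) - d * n / 2) →
                      ∀ K : SimpleGraph (Fin n), IsRegularGraph K d →
                        ∀ ρ : PMF (SimpleGraph (Fin n)), IsAddGnp ρ K p →
                          (ENNReal.ofReal (1 - c / (n : ℝ) ^ 14) ≤
                            prEvent ρ (fun F => ∀ v : Fin n,
                              (1 - C' * Real.sqrt (Real.log n / δ)) * δ ≤
                                  (deg (F \ K) v : ℝ) ∧
                                (deg (F \ K) v : ℝ) ≤
                                  (1 + C' * Real.sqrt (Real.log n / δ)) * δ)) ∧
                          ((d : ℝ) ≤ (n : ℝ) ^ σ → (m : ℝ) ≤ (n : ℝ) ^ ((1 : ℝ) + σ) →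
                            ENNReal.ofReal (1 - c / (n : ℝ) ^ 14) ≤
                              prEvent ρ (fun F => ∀ v : Fin n,
                                (1 - 2 / δ) * (deg (F \ K) v : ℝ) * δ * d ≤
                                    doubleDegSum F K v ∧
                                  doubleDegSum F K v ≤
                                    (1 + 2 / δ) * (deg (F \ K) v : ℝ) * δ * d)) := by
  refine ⟨1 / 100, by norm_num, fun ε hε _ C' hC' σ _ hσ => ⟨2 * C' ^ 2 / ε, ?_, fun c hc => ?_⟩⟩
  · have : 0 < C' := lt_of_lt_of_le (by norm_num) hC'
    positivity
  have hC' : 100 ≤ C' := by norm_num at hC'; exact hC'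
  obtain ⟨N, hN⟩ := exists_nat_ge (7 / c)
  refine ⟨max N 256, fun n hn d m hd _ hm_lo hm_hi δ p hδ hp K hK ρ hρ => ?_⟩
  have hn256 : 256 ≤ n := (le_max_right _ _).trans hn
  have hn_pos : 0 < n := by omega
  have hn1 : (256 : ℝ) ≤ n := by exact_mod_cast hn256
  have hn0 : (0 : ℝ) < n := by linarith
  have hnc : 7 ≤ c * n := by
    have h : (N : ℝ) ≤ n := by exact_mod_cast (le_max_left _ _).trans hn
    have := hN.trans h
    rwa [div_le_iff₀' hc] at this
  have hlog : 1 ≤ Real.log n := by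
    rw [Real.le_log_iff_exp_le hn0]
    linarith [Real.exp_one_lt_d9]
  have hC'0 : 0 < C' := by linarith
  have hC'2 : 10000 ≤ C' ^ 2 := by nlinarith
  have hεd : 2 * C' ^ 2 * Real.log n ≤ ε * d := by
    rw [div_mul_eq_mul_div, div_le_iff₀ hε] at hd
    linarith
  have hdε : ε * d ≤ δ := by
    rw [hδ, le_div_iff₀ hn0]
    linarith
  have hδlog : 2 * C' ^ 2 * Real.log n ≤ δ := hεd.trans hdε
  have hd0 : (0 : ℝ) ≤ d := Nat.cast_nonneg d
  have hdlog : 2 * C' ^ 2 * Real.log n ≤ d := hεd.trans (mul_le_of_le_one_left hd0 ‹ε ≤ 1›)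
  have hδ256 : 256 * Real.log n ≤ δ := by nlinarith
  have hd10240 : 10240 * Real.log n ≤ d := by nlinarith
  have hδ0 : 0 < δ := by linarith
  have hm0 : (0 : ℝ) < m := by
    by_contra! h
    have : (m : ℝ) = 0 := le_antisymm h (Nat.cast_nonneg m)
    simp [hδ, this] at hδ0
  rw [Nat.cast_choose_two] at hm_hi hp
  have hN0 : (0 : ℝ) < (n : ℝ) * (n - 1) / 2 - d * n / 2 := hm0.trans_le hm_hi
  have h₀ : 0 ≤ p := by rw [hp]; positivity
  have h₁ : p ≤ 1 := by rw [hp, div_le_one hN0]; exact hm_hi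
  have hpδ : p * (n - 1 - d) = δ := by
    have h : p * ((n : ℝ) * (n - 1) / 2 - d * n / 2) = m := by
      rw [hp, div_mul_cancel₀ _ hN0.ne']
    rw [hδ, eq_div_iff hn0.ne']
    linarith
  have hsmall : (n : ℝ) * (7 / (n : ℝ) ^ 16) ≤ c / (n : ℝ) ^ 14 := by
    rw [mul_div_assoc', div_le_div_iff₀ (by positivity) (by positivity)]
    have := mul_le_mul_of_nonneg_right hnc (pow_nonneg hn0.le 15)
    linarith [show c * n * (n : ℝ) ^ 15 = c * (n : ℝ) ^ 16 by ring,
      show 7 * (n : ℝ) ^ 15 = n * 7 * (n : ℝ) ^ 14 by ring]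
  have hn16 : (0 : ℝ) < (n : ℝ) ^ 16 := by positivity
  constructor
  · set s := Real.sqrt (Real.log n / δ) with hs
    have hs0 : 0 ≤ s := Real.sqrt_nonneg _
    have hs2 : s ^ 2 = Real.log n / δ := Real.sq_sqrt (by positivity)
    have hs1 : C' * s ≤ 2 := by
      refine abs_le_of_sq_le_sq' ?_ (by norm_num) |>.2
      rw [mul_pow, hs2, mul_div_assoc', div_le_iff₀ hδ0]
      linarith
    have hexp : (C' * s * δ) ^ 2 / (4 * δ) = C' ^ 2 * Real.log n / 4 := by
      rw [mul_pow, mul_pow, hs2]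
      field_simp
    refine le_prEvent_of_subsetPr_le hρ h₀ h₁ _
      (Q := fun S => ∃ v, C' * s * δ < |(incDeg S v : ℝ) - δ|) ?_ ?_
    · refine (subsetPr_exists_le h₀ h₁ _ _ fun v => subsetPr_incDeg_deviation_le hK h₀ h₁ v hpδ hδ0
        (by positivity) (mul_le_mul_of_nonneg_right hs1 hδ0.le)).trans ?_
      rw [hexp, Fintype.card_fin]
      refine le_trans (mul_le_mul_of_nonneg_left ?_ hn0.le) hsmall
      have := exp_neg_le_one_div_pow hn_pos (a := C' ^ 2 * Real.log n / 4) (by nlinarith)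
      calc _ ≤ 2 * (1 / (n : ℝ) ^ 16) := by linarith
        _ ≤ _ := by rw [mul_one_div]; gcongr; norm_num
    · intro S hS hQ v
      push Not at hQ
      have h := abs_le.1 (hQ v)
      rw [deg_sup_fromEdgeSet_sdiff hS]
      constructor <;> linarith [h.1, h.2]
  · intro hdσ hmσ
    have hpd := edge_prob_mul_le_one hn256 (hσ.trans (by norm_num)) hδ hpδ h₀ hdσ hmσ
    have hx : 1 ≤ Real.sqrt n := Real.one_le_sqrt.2 (by linarith)
    have hx40 : Real.sqrt n ^ 40 = (n : ℝ) ^ 20 := by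
      rw [show 40 = 2 * 20 from rfl, pow_mul, Real.sq_sqrt hn0.le]
    have hLd : 2 * 40 ≤ d := by
      have : (80 : ℝ) ≤ d := by linarith
      exact_mod_cast this
    refine le_prEvent_of_subsetPr_le hρ h₀ h₁ _
      (Q := fun S => ∃ v, 2 * (incDeg S v * d : ℝ) <
        |doubleDegSum (K ⊔ SimpleGraph.fromEdgeSet (S : Set (Sym2 (Fin n)))) K v -
          incDeg S v * δ * d|) ?_ ?_
    · refine (subsetPr_exists_le h₀ h₁ _ _ fun v => subsetPr_doubleDegSum_deviation_le hK h₀ h₁ v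
        hpδ (by linarith) (L := 40) (by norm_num) hLd hx).trans ?_
      rw [Fintype.card_fin, hx40]
      refine le_trans (mul_le_mul_of_nonneg_left ?_ hn0.le) hsmall
      have hA := exp_neg_le_one_div_pow hn_pos (a := δ / 16) (by linarith)
      have hC := exp_neg_le_one_div_pow hn_pos (a := d / (16 * (40 : ℕ))) (by
        push_cast
        linarith)
      have hB : (n : ℝ) * (Real.exp (p * (d * Real.sqrt n)) / (n : ℝ) ^ 20) ≤
          3 * (1 / (n : ℝ) ^ 16) := by
        have h3 : Real.exp (p * (d * Real.sqrt n)) ≤ 3 :=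
          (Real.exp_le_exp.2 hpd).trans (by linarith [Real.exp_one_lt_d9])
        calc _ ≤ (n : ℝ) * (3 / (n : ℝ) ^ 20) := by gcongr
          _ = 3 * (1 / (n : ℝ) ^ 19) := by field_simp
          _ ≤ _ := by
            gcongr
            · linarith
            · norm_num
      calc _ ≤ 2 * (1 / (n : ℝ) ^ 16) + (3 * (1 / (n : ℝ) ^ 16) + 2 * (1 / (n : ℝ) ^ 16)) := by
            linarith
        _ = _ := by ring
    · intro S hS hQ v
      push Not at hQ
      have h := abs_le.1 (hQ v)
      have hsub : (1 - 2 / δ) * (incDeg S v : ℝ) * δ * d =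
          incDeg S v * δ * d - 2 * (incDeg S v * d) := by field_simp
      have hadd : (1 + 2 / δ) * (incDeg S v : ℝ) * δ * d =
          incDeg S v * δ * d + 2 * (incDeg S v * d) := by field_simp
      rw [deg_sup_fromEdgeSet_sdiff hS, hsub, hadd]
      constructor <;> linarith [h.1, h.2]

end Sandwich
end
end
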